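/- arXiv:1812.07746 — 2 statements merged into one kernel-verified Lean document; each statement's English description precedes it below -/
import Mathlib

section
/- Under the recognition setup (conditions (1)–(5) below), for each a ∈ I the map Ψ_a : B → B ⊗ N_(a) defined by Ψ_a(v) = (e_a^⋆)^k v ⊗ z_a(-k), where k = tε_a^⋆(v), is a strict crystal embedding with respect to the first crystal structure (e_a, f_a, ε_a, φ_a, wt). -/
/-! Abstract crystals for generalized Kac–Moody (Borcherds) algebras. -/

/-- A Borcherds–Cartan matrix: integer matrix with `A a a = 2` or `A a a` nonpositive even,
nonpositive off-diagonal entries, and `A a b = 0 ↔ A b a = 0`. -/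
structure IsBorcherdsCartan {I : Type*} (A : I → I → ℤ) : Prop where
  diag : ∀ a, A a a = 2 ∨ (A a a ≤ 0 ∧ Even (A a a))
  offdiag : ∀ a b, a ≠ b → A a b ≤ 0
  zero_iff : ∀ a b, A a b = 0 ↔ A b a = 0

/-- The data of a crystal structure on a set `B`: partial operators `e`, `f`,
string functions `eps`, `phi` valued in `ℤ ∪ {-∞}`, and a weight function valued in the
root lattice `Q = ⊕_{a ∈ I} ℤ α_a`, modelled as `I →₀ ℤ` (so `α_a = Finsupp.single a 1`). -/
structure CrystalStructure (I B : Type*) where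
  e : I → B → Option B
  f : I → B → Option B
  eps : I → B → WithBot ℤ
  phi : I → B → WithBot ℤ
  wt : B → I →₀ ℤ

variable {I B : Type*}

/-- The pairing `⟨h_a, μ⟩` determined by `⟨h_a, α_b⟩ = A a b`. -/
def pairing (A : I → I → ℤ) (a : I) (μ : I →₀ ℤ) : ℤ :=
  μ.sum fun b m => A a b * m

/-- The axioms of an abstract `U_q(g)`-crystal for a Borcherds–Cartan matrix `A`. -/
def IsAbstractCrystal (A : I → I → ℤ) (C : CrystalStructure I B) : Prop :=
  (∀ a v w, C.e a v = some w → C.wt w = C.wt v + Finsupp.single a 1) ∧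
  (∀ a v w, C.f a v = some w → C.wt w = C.wt v - Finsupp.single a 1) ∧
  (∀ a v, C.phi a v = C.eps a v + ((pairing A a (C.wt v) : ℤ) : WithBot ℤ)) ∧
  (∀ a v w, C.f a v = some w ↔ C.e a w = some v) ∧
  (∀ a v w, C.e a v = some w →
    (A a a = 2 → C.eps a w + 1 = C.eps a v ∧ C.phi a w = C.phi a v + 1) ∧
    (A a a ≤ 0 → C.eps a w = C.eps a v ∧ C.phi a w = C.phi a v + ((A a a : ℤ) : WithBot ℤ))) ∧
  (∀ a v w, C.f a v = some w →
    (A a a = 2 → C.eps a w = C.eps a v + 1 ∧ C.phi a w + 1 = C.phi a v) ∧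
    (A a a ≤ 0 → C.eps a w = C.eps a v ∧ C.phi a w + ((A a a : ℤ) : WithBot ℤ) = C.phi a v)) ∧
  (∀ a v, C.phi a v = ⊥ → C.e a v = none ∧ C.f a v = none)

/-- One step in the crystal graph. -/
def CrystalStep (C : CrystalStructure I B) (v w : B) : Prop :=
  ∃ a, C.e a v = some w ∨ C.f a v = some w

/-- A crystal is connected if any two elements are joined by a chain of crystal operators. -/
def CrystalConnected (C : CrystalStructure I B) : Prop :=
  ∀ v w, Relation.ReflTransGen (CrystalStep C) v w

/-- Iteration of a partial map. -/
def iterOpt {α : Type*} (g : α → Option α) : ℕ → α → Option α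
  | 0, v => some v
  | k + 1, v => (iterOpt g k v).bind g

/-- `κ_a(v)`, defined from the two crystal structures via the maximal numbers of times
the operators `e_a` resp. `e_a^⋆` can be applied (`te`, `teS`). -/
def kappaFun (A : I → I → ℤ) (C : CrystalStructure I B) (te teS : I → B → ℕ) (a : I) (v : B) : ℤ :=
  if A a a = 2 then (te a v : ℤ) + (teS a v : ℤ) + pairing A a (C.wt v)
  else 0 + (teS a v : ℤ) * A a a + pairing A a (C.wt v)

/-- The elementary crystal `N_(a)`, with underlying set `ℕ` (where `n` stands for
`z_a(-n)`). -/
noncomputable def NData [DecidableEq I] (A : I → I → ℤ) (a : I) : CrystalStructure I ℕ where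
  e := fun b n => if b = a then (match n with | 0 => none | m + 1 => some m) else none
  f := fun b n => if b = a then some (n + 1) else none
  eps := fun b n => if b = a then (if A a a = 2 then ((n : ℤ) : WithBot ℤ) else (0 : WithBot ℤ))
    else ⊥
  phi := fun b n => if b = a then
      (if A a a = 2 then ((-(n : ℤ) : ℤ) : WithBot ℤ) else ((-(n : ℤ) * A a a : ℤ) : WithBot ℤ))
    else ⊥
  wt := fun n => Finsupp.single a (-(n : ℤ))

/-- The tensor product of two crystal structures (for generalized Kac–Moody algebras). -/
noncomputable def tensorCS {B₁ B₂ : Type*} (A : I → I → ℤ)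
    (C₁ : CrystalStructure I B₁) (C₂ : CrystalStructure I B₂) :
    CrystalStructure I (B₁ × B₂) where
  f := fun c p =>
    if C₂.eps c p.2 < C₁.phi c p.1 then (C₁.f c p.1).map (fun w => (w, p.2))
    else (C₂.f c p.2).map (fun w => (p.1, w))
  e := fun c p =>
    if A c c = 2 then
      if C₂.eps c p.2 ≤ C₁.phi c p.1 then (C₁.e c p.1).map (fun w => (w, p.2))
      else (C₂.e c p.2).map (fun w => (p.1, w))
    else
      if C₂.eps c p.2 + ((-(A c c) : ℤ) : WithBot ℤ) < C₁.phi c p.1 then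
        (C₁.e c p.1).map (fun w => (w, p.2))
      else if C₂.eps c p.2 < C₁.phi c p.1 then none
      else (C₂.e c p.2).map (fun w => (p.1, w))
  eps := fun c p =>
    max (C₁.eps c p.1) (C₂.eps c p.2 + ((-(pairing A c (C₁.wt p.1)) : ℤ) : WithBot ℤ))
  phi := fun c p =>
    max (C₁.phi c p.1 + ((pairing A c (C₂.wt p.2) : ℤ) : WithBot ℤ)) (C₂.phi c p.2)
  wt := fun p => C₁.wt p.1 + C₂.wt p.2

theorem aux_pairing_add {I : Type*} (A : I → I → ℤ) (a : I) (μ ν : I →₀ ℤ) :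
    pairing A a (μ + ν) = pairing A a μ + pairing A a ν := by
  classical
  unfold pairing
  exact Finsupp.sum_add_index' (by simp) (by intros; ring)

theorem aux_pairing_single {I : Type*} (A : I → I → ℤ) (a b : I) (m : ℤ) :
    pairing A a (Finsupp.single b m) = A a b * m := by
  unfold pairing
  exact Finsupp.sum_single_index (by simp)

theorem aux_iter_succ {α : Type*} (g : α → Option α) (k : ℕ) (v : α) :
    iterOpt g (k + 1) v = (g v).bind (iterOpt g k) := by
  induction k with
  | zero =>
    show g v = (g v).bind fun x => some x
    cases g v <;> rfl
  | succ k ih =>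
    rw [iterOpt, ih]
    cases g v <;> rfl

theorem aux_iter_mono {α : Type*} (g : α → Option α) (v : α) (k m : ℕ) (h : k ≤ m)
    (hk : iterOpt g k v = none) : iterOpt g m v = none := by
  induction m, h using Nat.le_induction with
  | base => exact hk
  | succ m _ ih => rw [iterOpt, ih]; rfl

theorem aux_t_unique {α : Type*} (g : α → Option α) (v : α) (k m : ℕ)
    (hk : iterOpt g k v ≠ none ∧ iterOpt g (k + 1) v = none)
    (hm : iterOpt g m v ≠ none ∧ iterOpt g (m + 1) v = none) : k = m := by
  by_contra hne
  rcases Nat.lt_or_gt_of_ne hne with h | h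
  · exact hm.1 (aux_iter_mono g v _ _ h hk.2)
  · exact hk.1 (aux_iter_mono g v _ _ h hm.2)

theorem aux_t_step {α : Type*} (g : α → Option α) (t : α → ℕ)
    (ht : ∀ v, iterOpt g (t v) v ≠ none ∧ iterOpt g (t v + 1) v = none)
    (v w : α) (h : g v = some w) : t v = t w + 1 := by
  refine aux_t_unique g v _ _ (ht v) ?_
  rw [aux_iter_succ, aux_iter_succ, h]
  exact ht w

theorem aux_t_zero {α : Type*} (g : α → Option α) (t : α → ℕ)
    (ht : ∀ v, iterOpt g (t v) v ≠ none ∧ iterOpt g (t v + 1) v = none)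
    (v : α) (h : g v = none) : t v = 0 := by
  refine aux_t_unique g v _ _ (ht v) ⟨by simp [iterOpt], by simp [iterOpt, h]⟩

/-- Elements reachable from `v0` by the operators `F`. -/
inductive AuxReach {I B : Type*} (F : I → B → B) (v0 : B) : B → Prop
  | zero : AuxReach F v0 v0
  | succ (c : I) (v : B) : AuxReach F v0 v → AuxReach F v0 (F c v)

/-- Under the recognition setup, for every `a ∈ I` the map
`Ψ_a(v) = (e_a^⋆)^k v ⊗ z_a(-k)`, with `k = tε_a^⋆(v)`, is a strict crystal embedding
`B ↪ B ⊗ N_(a)` for the first crystal structure. -/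
theorem recognition_Psi_strict_embedding
    {I B : Type*} [DecidableEq I] (A : I → I → ℤ) (hA : IsBorcherdsCartan A)
    (C S : CrystalStructure I B)
    (hC : IsAbstractCrystal A C) (hS : IsAbstractCrystal A S)
    (hwt : S.wt = C.wt)
    (hconnC : CrystalConnected C) (hconnS : CrystalConnected S)
    (v0 : B)
    (hv0C : ∀ a, C.e a v0 = none) (hv0S : ∀ a, S.e a v0 = none)
    (hwt0 : C.wt v0 = 0) (huniq : ∀ v, C.wt v = 0 → v = v0)
    (te teS : I → B → ℕ)
    (hte : ∀ a v, iterOpt (C.e a) (te a v) v ≠ none ∧ iterOpt (C.e a) (te a v + 1) v = none)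
    (hteS : ∀ a v, iterOpt (S.e a) (teS a v) v ≠ none ∧ iterOpt (S.e a) (teS a v + 1) v = none)
    (heps : ∀ a v, (A a a = 2 → C.eps a v = ((te a v : ℤ) : WithBot ℤ)) ∧
      (A a a ≤ 0 → C.eps a v = 0))
    (hepsS : ∀ a v, (A a a = 2 → S.eps a v = ((teS a v : ℤ) : WithBot ℤ)) ∧
      (A a a ≤ 0 → S.eps a v = 0))
    (h1 : ∀ a v, C.f a v ≠ none ∧ S.f a v ≠ none)
    (h2 : ∀ a b, a ≠ b → ∀ v, (C.f b v).bind (S.f a) = (S.f a v).bind (C.f b)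
      ∧ (∀ w, C.f b v = some w → teS a w = teS a v)
      ∧ (∀ w, S.f a v = some w → te b w = te b v))
    (h3 : ∀ a v, kappaFun A C te teS a v = 0 → C.f a v = S.f a v)
    (h4 : ∀ a v, A a a = 2 → 0 ≤ kappaFun A C te teS a v
      ∧ (1 ≤ kappaFun A C te teS a v →
          (∀ w, C.f a v = some w → S.eps a w = S.eps a v) ∧
          (∀ w, S.f a v = some w → C.eps a w = C.eps a v))
      ∧ (2 ≤ kappaFun A C te teS a v → (C.f a v).bind (S.f a) = (S.f a v).bind (C.f a)))
    (h5 : ∀ a v, A a a ≤ 0 → 0 < kappaFun A C te teS a v →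
      (∀ w, C.f a v = some w → teS a w = teS a v) ∧
      (C.f a v).bind (S.f a) = (S.f a v).bind (C.f a)) :
    ∀ a : I, ∃ Ψ : B → B × ℕ,
      (∀ v, iterOpt (S.e a) (teS a v) v = some (Ψ v).1 ∧ (Ψ v).2 = teS a v) ∧
      Function.Injective Ψ ∧
      (∀ c v, Option.map Ψ (C.e c v) = (tensorCS A C (NData A a)).e c (Ψ v)) ∧
      (∀ c v, Option.map Ψ (C.f c v) = (tensorCS A C (NData A a)).f c (Ψ v)) ∧
      (∀ c v, (tensorCS A C (NData A a)).eps c (Ψ v) = C.eps c v) ∧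
      (∀ c v, (tensorCS A C (NData A a)).phi c (Ψ v) = C.phi c v) ∧
      (∀ v, (tensorCS A C (NData A a)).wt (Ψ v) = C.wt v) := by
  obtain ⟨hCe, hCf, hCphi, hCfe, -, -, -⟩ := hC
  obtain ⟨hSe, hSf, hSphi, hSfe, -, -, -⟩ := hS
  have hF' : ∀ c v, ∃ w, C.f c v = some w := fun c v => Option.ne_none_iff_exists'.1 (h1 c v).1
  have hG' : ∀ c v, ∃ w, S.f c v = some w := fun c v => Option.ne_none_iff_exists'.1 (h1 c v).2
  choose F hF using hF'
  choose G hG using hG'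
  have heF : ∀ c v w, C.e c v = some w ↔ v = F c w := by
    intro c v w; rw [← hCfe, hF]; simp [eq_comm]
  have heG : ∀ c v w, S.e c v = some w ↔ v = G c w := by
    intro c v w; rw [← hSfe, hG]; simp [eq_comm]
  have Finj : ∀ c v w, F c v = F c w → v = w := by
    intro c v w h
    have h1 := (heF c (F c v) v).2 rfl
    have h2 := (heF c (F c v) w).2 h
    rw [h1] at h2; simpa using h2
  have Ginj : ∀ c v w, G c v = G c w → v = w := by
    intro c v w h
    have h1 := (heG c (G c v) v).2 rfl
    have h2 := (heG c (G c v) w).2 h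
    rw [h1] at h2; simpa using h2
  have teF : ∀ c v, te c (F c v) = te c v + 1 := fun c v =>
    aux_t_step (C.e c) (te c) (hte c) _ _ ((heF c _ _).2 rfl)
  have teSG : ∀ c v, teS c (G c v) = teS c v + 1 := fun c v =>
    aux_t_step (S.e c) (teS c) (hteS c) _ _ ((heG c _ _).2 rfl)
  have te0 : ∀ c v, C.e c v = none → te c v = 0 := fun c v h =>
    aux_t_zero (C.e c) (te c) (hte c) v h
  have teS0 : ∀ c v, S.e c v = none → teS c v = 0 := fun c v h =>
    aux_t_zero (S.e c) (teS c) (hteS c) v h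
  have exF : ∀ c v, 0 < te c v → ∃ y, v = F c y := by
    intro c v h
    cases hv : C.e c v with
    | none => have := te0 c v hv; omega
    | some y => exact ⟨y, (heF c v y).1 hv⟩
  have exG : ∀ c v, 0 < teS c v → ∃ y, v = G c y := by
    intro c v h
    cases hv : S.e c v with
    | none => have := teS0 c v hv; omega
    | some y => exact ⟨y, (heG c v y).1 hv⟩
  obtain ⟨p, hp⟩ : ∃ p : I → B → ℤ, ∀ c v, p c v = pairing A c (C.wt v) := ⟨_, fun _ _ => rfl⟩
  have pF : ∀ c b v, p c (F b v) = p c v - A c b := by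
    intro c b v
    have := hCf b v _ (hF b v)
    have h2 : C.wt v = C.wt (F b v) + Finsupp.single b 1 := by rw [this]; abel
    rw [hp, hp, h2, aux_pairing_add, aux_pairing_single]; ring
  have wtG : ∀ b v, C.wt v = C.wt (G b v) + Finsupp.single b 1 := by
    intro b v
    have := hSf b v _ (hG b v)
    rw [hwt] at this
    rw [this]; abel
  have pG : ∀ c b v, p c (G b v) = p c v - A c b := by
    intro c b v
    rw [hp, hp, wtG b v, aux_pairing_add, aux_pairing_single]; ring
  obtain ⟨K, hK⟩ : ∃ K : I → B → ℤ, ∀ c v, kappaFun A C te teS c v = K c v := ⟨_, fun _ _ => rfl⟩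
  have Kre : ∀ c v, A c c = 2 → K c v = te c v + teS c v + p c v := by
    intro c v h; rw [← hK, kappaFun, if_pos h, hp]
  have Kim : ∀ c v, A c c ≤ 0 → K c v = teS c v * A c c + p c v := by
    intro c v h; rw [← hK, kappaFun, if_neg (by omega), hp]; ring
  have im : ∀ c, A c c = 2 ∨ A c c ≤ 0 := fun c => (hA.diag c).imp id And.left
  simp only [hK] at h3 h4 h5
  have c2 : ∀ a b, a ≠ b → ∀ v, G a (F b v) = F b (G a v) ∧ teS a (F b v) = teS a v ∧
      te b (G a v) = te b v := by
    intro a b hab v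
    obtain ⟨x, y, z⟩ := h2 a b hab v
    refine ⟨?_, y _ (hF b v), z _ (hG a v)⟩
    simpa [hF, hG] using x
  have c3 : ∀ a v, K a v = 0 → F a v = G a v := by
    intro a v h; simpa [hF, hG] using h3 a v h
  have c40 : ∀ a v, A a a = 2 → 0 ≤ K a v := fun a v h => (h4 a v h).1
  have c41 : ∀ a v, A a a = 2 → 1 ≤ K a v → teS a (F a v) = teS a v ∧ te a (G a v) = te a v := by
    intro a v h hk
    have h' := (h4 a v h).2.1 hk
    have e1 := h'.1 _ (hF a v)
    have e2 := h'.2 _ (hG a v)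
    rw [(hepsS a _).1 h, (hepsS a _).1 h] at e1
    rw [(heps a _).1 h, (heps a _).1 h] at e2
    exact ⟨by exact_mod_cast e1, by exact_mod_cast e2⟩
  have c42 : ∀ a v, A a a = 2 → 2 ≤ K a v → G a (F a v) = F a (G a v) := by
    intro a v h hk
    have := (h4 a v h).2.2 hk
    simpa [hF, hG] using this
  have c5 : ∀ a v, A a a ≤ 0 → 0 < K a v → teS a (F a v) = teS a v ∧
      G a (F a v) = F a (G a v) := by
    intro a v h hk
    obtain ⟨x, y⟩ := h5 a v h hk
    exact ⟨x _ (hF a v), by simpa [hF, hG] using y⟩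
  -- behaviour of κ under the operators
  have KGim : ∀ c v, A c c ≤ 0 → K c (G c v) = K c v := by
    intro c v h
    rw [Kim c _ h, Kim c _ h, teSG, pG]; push_cast; ring
  have KG0 : ∀ c v, A c c = 2 → K c v = 0 → K c (G c v) = 0 := by
    intro c v h hk
    have e1 := c3 c v hk
    have e2 : te c (G c v) = te c v + 1 := by rw [← e1, teF]
    rw [Kre c _ h] at hk ⊢
    rw [e2, teSG, pG, h]; push_cast; linarith
  have KG1 : ∀ c v, A c c = 2 → 1 ≤ K c v → K c (G c v) = K c v - 1 := by
    intro c v h hk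
    have e2 := (c41 c v h hk).2
    rw [Kre c _ h, Kre c _ h, e2, teSG, pG, h]; push_cast; linarith
  have KF1 : ∀ c v, A c c = 2 → 1 ≤ K c v → K c (F c v) = K c v - 1 := by
    intro c v h hk
    have e2 := (c41 c v h hk).1
    rw [Kre c _ h, Kre c _ h, e2, teF, pF, h]; push_cast; linarith
  -- everything is reachable from `v0`
  have Rk : ∀ v, AuxReach F v0 v → ∀ c, 0 ≤ K c v := by
    intro v hv c
    rcases im c with h | h
    · exact c40 c v h
    induction hv with
    | zero =>
      rw [Kim c _ h, teS0 c _ (hv0S c), hp, hwt0]; simp [pairing]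
    | succ b v hv ih =>
      by_cases hbc : c = b
      · subst hbc
        rcases ih.eq_or_lt with h0 | h0
        · rw [c3 c v h0.symm, KGim c v h]; exact ih
        · have := (c5 c v h h0).1
          rw [Kim c _ h] at ih ⊢
          rw [this, pF]; linarith
      · have := (c2 c b hbc v).2.1
        have h2 := hA.offdiag c b hbc
        rw [Kim c _ h] at ih ⊢
        rw [this, pF]; linarith
  have RG : ∀ v, AuxReach F v0 v → ∀ c, AuxReach F v0 (G c v) := by
    intro v hv c
    induction hv with
    | zero =>
      have : K c v0 = 0 := by
        have hp0 : p c v0 = 0 := by rw [hp, hwt0]; simp [pairing]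
        rcases im c with h | h
        · rw [Kre c _ h, te0 c _ (hv0C c), teS0 c _ (hv0S c), hp0]; simp
        · rw [Kim c _ h, teS0 c _ (hv0S c), hp0]; simp
      rw [← c3 c v0 this]; exact .succ _ _ .zero
    | succ b v hv ih =>
      by_cases hbc : c = b
      · subst hbc
        have key : K c (F c v) = 0 ∨ G c (F c v) = F c (G c v) := by
          have k0 := Rk v hv c
          rcases im c with h | h
          · rcases (show K c v = 0 ∨ K c v = 1 ∨ 2 ≤ K c v by omega) with hk | hk | hk
            · left; rw [c3 c v hk]; exact KG0 c v h hk
            · left; rw [KF1 c v h (by omega)]; omega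
            · right; exact c42 c v h hk
          · rcases k0.eq_or_lt with hk | hk
            · left; rw [c3 c v hk.symm, KGim c v h]; exact hk.symm
            · right; exact (c5 c v h hk).2
        rcases key with hk | hk
        · rw [← c3 c _ hk]; exact .succ _ _ (.succ _ _ hv)
        · rw [hk]; exact .succ _ _ ih
      · rw [(c2 c b hbc v).1]; exact .succ _ _ ih
  have RE : ∀ v, AuxReach F v0 v → ∀ c x, v = G c x → AuxReach F v0 x := by
    intro v hv c
    induction hv with
    | zero =>
      intro x hx
      have := (heG c _ _).2 hx
      rw [hv0S] at this; simp at this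
    | succ b v hv ih =>
      intro x hx
      -- it is enough to commute past
      have fin : (∃ y, v = G c y ∧ G c (F b y) = F b (G c y)) → AuxReach F v0 x := by
        rintro ⟨y, hy, hc⟩
        rw [hy, ← hc] at hx
        rw [← Ginj _ _ _ hx]
        exact .succ _ _ (ih y hy)
      have hpos : 0 < teS c (F b v) := by rw [hx, teSG]; omega
      by_cases hbc : c = b
      · subst hbc
        by_cases hk : K c v = 0
        · rw [c3 c v hk] at hx
          rw [← Ginj _ _ _ hx]; exact hv
        have k0 := Rk v hv c
        rcases im c with h | h
        · have e := (c41 c v h (by omega)).1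
          obtain ⟨y, hy⟩ := exG c v (by omega)
          refine fin ⟨y, hy, c42 c y h ?_⟩
          have hy0 := c40 c y h
          rcases hy0.eq_or_lt with h0 | h0
          · exact absurd (hy ▸ KG0 c y h h0.symm) hk
          · have := KG1 c y h (by omega)
            rw [← hy] at this; omega
        · have e := (c5 c v h (by omega)).1
          obtain ⟨y, hy⟩ := exG c v (by omega)
          refine fin ⟨y, hy, (c5 c y h ?_).2⟩
          rw [← KGim c y h, ← hy]; omega
      · have e := (c2 c b hbc v).2.1
        obtain ⟨y, hy⟩ := exG c v (by omega)
        exact fin ⟨y, hy, (c2 c b hbc y).1⟩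
  have Rall : ∀ v, AuxReach F v0 v := by
    intro v
    induction hconnS v0 v with
    | refl => exact .zero
    | tail _ hs ih =>
      obtain ⟨c, hc | hc⟩ := hs
      · exact RE _ ih c _ ((heG _ _ _).1 hc)
      · rw [hG] at hc
        rw [← Option.some.inj hc]; exact RG _ ih c
  have K0 : ∀ c v, 0 ≤ K c v := fun c v => Rk v (Rall v) c
  clear Rk RG RE Rall
  -- the map
  intro a
  obtain ⟨U, hU⟩ : ∃ U : B → B, ∀ v, iterOpt (S.e a) (teS a v) v = some (U v) :=
    ⟨_, fun v => (Option.ne_none_iff_exists'.1 (hteS a v).1).choose_spec⟩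
  have UG : ∀ v, U (G a v) = U v := by
    intro v
    have e := hU (G a v)
    rw [teSG, aux_iter_succ, (heG a _ _).2 rfl] at e
    have e2 := hU v
    simp only [Option.bind_some] at e
    rw [e2] at e; exact (Option.some.inj e).symm
  have Uz : ∀ v, teS a v = 0 → U v = v := by
    intro v h
    have e := hU v
    rw [h] at e; exact (Option.some.inj e).symm
  -- induction principle along `G a` strings
  have ind : ∀ P : B → Prop, (∀ v, teS a v = 0 → P v) → (∀ y, P y → P (G a y)) → ∀ v, P v := by
    intro P hz hs v
    induction hn : teS a v generalizing v with
    | zero => exact hz v hn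
    | succ n ih =>
      obtain ⟨y, rfl⟩ := exG a v (by omega)
      rw [teSG] at hn
      exact hs y (ih y (by omega))
  have Uinj : ∀ v w, U v = U w → teS a v = teS a w → v = w := by
    refine ind _ ?_ ?_
    · intro v hv w h1 h2
      rw [Uz v hv, Uz w (by omega)] at h1; exact h1
    · intro y ih w h1 h2
      rw [teSG] at h2
      obtain ⟨z, rfl⟩ := exG a w (by omega)
      rw [teSG] at h2
      rw [UG, UG] at h1
      rw [ih z h1 (by omega)]
  have teSU : ∀ v, teS a (U v) = 0 := by
    refine ind _ ?_ ?_
    · intro v hv; rw [Uz v hv, hv]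
    · intro y ih; rw [UG, ih]
  have wtU : ∀ v, C.wt (U v) + Finsupp.single a (-(teS a v : ℤ)) = C.wt v := by
    refine ind _ ?_ ?_
    · intro v hv; rw [Uz v hv, hv]; simp
    · intro y ih
      rw [UG, teSG]
      have := wtG a y
      rw [← ih] at this
      have h2 : C.wt (G a y) = C.wt (U y) + Finsupp.single a (-(teS a y : ℤ))
        - Finsupp.single a 1 := by rw [this]; abel
      rw [h2, add_sub_assoc, ← Finsupp.single_sub]; push_cast
      congr 2; ring
  have pU : ∀ c v, p c v = p c (U v) - teS a v * A c a := by
    intro c v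
    rw [hp, hp, ← wtU v, aux_pairing_add, aux_pairing_single]; ring
  have teU : ∀ c, c ≠ a → ∀ v, te c (U v) = te c v := by
    intro c hc
    refine ind _ ?_ ?_
    · intro v hv; rw [Uz v hv]
    · intro y ih; rw [UG, ih, (c2 a c hc.symm y).2.2]
  have KUim : A a a ≤ 0 → ∀ v, K a v = p a (U v) := by
    intro h v; rw [Kim a v h, pU a v]; ring
  have KUre : A a a = 2 → ∀ v, K a v = max (te a (U v) + p a (U v) - teS a v) 0 := by
    intro h
    refine ind _ ?_ ?_
    · intro v hv
      have := c40 a v h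
      have e := Kre a v h
      rw [Uz v hv, hv] at *
      rw [max_eq_left] <;> push_cast at * <;> linarith
    · intro y ih
      rw [UG, teSG]
      rcases (c40 a y h).eq_or_lt with h0 | h0
      · rw [KG0 a y h h0.symm]
        rw [← h0] at ih
        push_cast; omega
      · rw [KG1 a y h (by omega)]
        push_cast; omega
  have teFre : A a a = 2 → ∀ v, (te a v : ℤ) = max (te a (U v) : ℤ) (teS a v - p a (U v)) := by
    intro h v
    have e1 := KUre h v
    have e2 := Kre a v h
    have e3 := pU a v
    rw [h] at e3
    omega
  -- image of `F`
  have FU1 : ∀ c, c ≠ a → ∀ v, U (F c v) = F c (U v) ∧ teS a (F c v) = teS a v := by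
    intro c hc v
    refine ⟨?_, (c2 a c hc.symm v).2.1⟩
    revert v
    refine ind _ ?_ ?_
    · intro v hv
      rw [Uz v hv, Uz _ (by rw [(c2 a c hc.symm v).2.1, hv])]
    · intro y ih
      rw [UG, ← (c2 a c hc.symm y).1, UG, ih]
  have FU2 : ∀ v, 0 < K a v → U (F a v) = F a (U v) ∧ teS a (F a v) = teS a v := by
    have e : ∀ v, 0 < K a v → teS a (F a v) = teS a v := by
      intro v hk
      rcases im a with h | h
      · exact (c41 a v h hk).1
      · exact (c5 a v h hk).1
    intro v hk
    refine ⟨?_, e v hk⟩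
    revert v
    refine ind _ ?_ ?_
    · intro v hv hk
      rw [Uz v hv, Uz _ (by rw [e v hk, hv])]
    · intro y ih hk
      have key : 0 < K a y ∧ G a (F a y) = F a (G a y) := by
        rcases im a with h | h
        · rcases (c40 a y h).eq_or_lt with h0 | h0
          · rw [KG0 a y h h0.symm] at hk; omega
          · rw [KG1 a y h (by omega)] at hk
            exact ⟨h0, c42 a y h (by omega)⟩
        · rw [KGim a y h] at hk
          exact ⟨hk, (c5 a y h hk).2⟩
      rw [UG, ← key.2, UG, ih key.1]
  have FU3 : ∀ v, K a v = 0 → U (F a v) = U v ∧ teS a (F a v) = teS a v + 1 := by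
    intro v hk
    rw [c3 a v hk, UG, teSG]; exact ⟨rfl, rfl⟩
  -- eps and phi as integers
  obtain ⟨ep, hep⟩ : ∃ ep : I → B → ℤ, ∀ c v, C.eps c v = ((ep c v : ℤ) : WithBot ℤ) := by
    refine ⟨fun c v => if A c c = 2 then te c v else 0, fun c v => ?_⟩
    rcases im c with h | h
    · rw [(heps c v).1 h]; simp [h]
    · rw [(heps c v).2 h]; simp [show ¬ A c c = 2 by omega]
  have epre : ∀ c v, A c c = 2 → ep c v = te c v := by
    intro c v h
    have := (heps c v).1 h
    rw [hep] at this; exact_mod_cast this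
  have epim : ∀ c v, A c c ≤ 0 → ep c v = 0 := by
    intro c v h
    have := (heps c v).2 h
    rw [hep] at this; exact_mod_cast this
  have hphi : ∀ c v, C.phi c v = ((ep c v + p c v : ℤ) : WithBot ℤ) := by
    intro c v; rw [hCphi, hep, hp]; rfl
  have epU : ∀ c, c ≠ a → ∀ v, ep c (U v) = ep c v := by
    intro c hc v
    rcases im c with h | h
    · rw [epre c _ h, epre c _ h, teU c hc]
    · rw [epim c _ h, epim c _ h]
  have hf : ∀ c v, Option.map (fun v => (U v, teS a v)) (C.f c v)
      = (tensorCS A C (NData A a)).f c (U v, teS a v) := by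
    intro c v
    rw [hF]
    by_cases hc : c = a
    · subst hc
      have hk0 := K0 c v
      have cond : ((NData A c).eps c (teS c v) < C.phi c (U v)) ↔ 0 < K c v := by
        rw [hphi]
        rcases im c with h | h
        · simp only [NData, if_true, if_pos h, WithBot.coe_lt_coe]
          rw [KUre h, epre c _ h]; omega
        · simp only [NData, if_true, if_neg (show ¬ A c c = 2 by omega)]
          rw [KUim h, epim c _ h, zero_add]
          exact WithBot.coe_lt_coe
      simp only [tensorCS, cond]
      by_cases hk : 0 < K c v
      · rw [if_pos hk, hF]
        simp [FU2 v hk]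
      · rw [if_neg hk]
        simp [NData, FU3 v (by omega)]
    · simp [tensorCS, NData, hc, hphi, hF, FU1 c hc v]
  refine ⟨fun v => (U v, teS a v), fun v => ⟨hU v, rfl⟩, ?_, ?_, hf, ?_, ?_, wtU⟩
  · intro v w h
    simp only [Prod.mk.injEq] at h
    exact Uinj v w h.1 h.2
  · intro c v
    by_cases hc : c = a
    · subst hc
      rcases im c with h | h
      · -- real
        cases hv : C.e c v with
        | none =>
          have e0 := te0 c v hv
          have e1 := teFre h v
          have e2 : te c (U v) = 0 := by omega
          have e3 : C.e c (U v) = none := by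
            cases hu : C.e c (U v) with
            | none => rfl
            | some y => rw [(heF _ _ _).1 hu, teF] at e2; omega
          have cond : ((NData A c).eps c (teS c v) ≤ C.phi c (U v)) := by
            rw [hphi]
            simp only [NData, if_true, if_pos h, WithBot.coe_le_coe]
            rw [epre c _ h]; omega
          simp only [tensorCS, if_pos h, if_pos cond, e3]; rfl
        | some y =>
          have hy := (heF c v y).1 hv
          subst hy
          have hk0 := K0 c y
          by_cases hk : 0 < K c y
          · obtain ⟨q1, q2⟩ := FU2 y hk
            have cond : ((NData A c).eps c (teS c y) ≤ C.phi c (F c (U y))) := by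
              rw [hphi]
              simp only [NData, if_true, if_pos h, WithBot.coe_le_coe]
              rw [KUre h] at hk
              rw [epre c _ h, teF, pF, h]; push_cast; omega
            simp only [tensorCS, if_pos h, q1, q2, if_pos cond, (heF c (F c (U y)) (U y)).2 rfl]
            rfl
          · obtain ⟨q1, q2⟩ := FU3 y (by omega)
            have cond : ¬ ((NData A c).eps c (teS c y + 1) ≤ C.phi c (U y)) := by
              rw [hphi]
              simp only [NData, if_true, if_pos h, WithBot.coe_le_coe]
              rw [KUre h] at hk
              rw [epre c _ h]; push_cast; omega
            simp only [tensorCS, if_pos h, q1, q2, if_neg cond]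
            simp [NData]
      · -- imaginary
        have h2 : ¬ A c c = 2 := by omega
        have cond1 : ∀ w n, ((NData A c).eps c n + ((-(A c c) : ℤ) : WithBot ℤ) < C.phi c w) ↔
            - A c c < p c w := by
          intro w n
          rw [hphi, epim c _ h]
          simp only [NData, if_true, if_neg h2, zero_add]
          exact WithBot.coe_lt_coe
        have cond2 : ∀ w n, ((NData A c).eps c n < C.phi c w) ↔ 0 < p c w := by
          intro w n
          rw [hphi, epim c _ h]
          simp only [NData, if_true, if_neg h2, zero_add]
          exact WithBot.coe_lt_coe
        simp only [tensorCS, if_neg h2, cond1, cond2]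
        cases hv : C.e c v with
        | none =>
          have hk0 := K0 c v
          rw [KUim h] at hk0
          split_ifs with g1 g2
          · cases hu : C.e c (U v) with
            | none => rfl
            | some y =>
              exfalso
              have hy := (heF _ _ _).1 hu
              have hyk : 0 < K c y := by
                refine lt_of_le_of_ne (K0 c y) fun h0 => ?_
                have t := teSU v
                rw [hy, c3 c y h0.symm, teSG] at t
                omega
              have hy0 : teS c y = 0 := by
                rw [← (c5 c y h hyk).1, ← hy]; exact teSU v
              obtain ⟨t, ht1, ht2⟩ : ∃ t, U t = y ∧ teS c t = teS c v := by
                have : ∀ n : ℕ, ∃ t, U t = y ∧ teS c t = n := by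
                  intro n
                  induction n with
                  | zero => exact ⟨y, Uz y hy0, hy0⟩
                  | succ n ih =>
                    obtain ⟨t, q1, q2⟩ := ih
                    exact ⟨G c t, by rw [UG, q1], by rw [teSG, q2]⟩
                exact this _
              have hkt : 0 < K c t := by
                rw [KUim h] at hyk ⊢
                rw [ht1]; rwa [Uz y hy0] at hyk
              obtain ⟨q1, q2⟩ := FU2 t hkt
              have := Uinj (F c t) v (by rw [q1, ht1, hy]) (by rw [q2, ht2])
              rw [(heF c v t).2 this.symm] at hv
              simp at hv
          · rfl
          · cases hn : teS c v with
            | zero => simp [NData]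
            | succ n =>
              exfalso
              obtain ⟨y, rfl⟩ := exG c v (by omega)
              have hky : K c y = 0 := by
                rw [KUim h]; rw [UG] at *; omega
              rw [(heF c _ y).2 (c3 c y hky).symm] at hv
              simp at hv
        | some y =>
          have hy := (heF c v y).1 hv
          subst hy
          have hk0 := K0 c y
          by_cases hk : 0 < K c y
          · obtain ⟨q1, q2⟩ := FU2 y hk
            rw [KUim h] at hk
            rw [q1, q2, if_pos (by rw [pF]; omega), (heF c (F c (U y)) (U y)).2 rfl]
            rfl
          · obtain ⟨q1, q2⟩ := FU3 y (by omega)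
            rw [KUim h] at hk
            rw [q1, q2, if_neg (by omega), if_neg (by omega)]
            simp [NData]
    · have key : C.e c (U v) = Option.map U (C.e c v) := by
        cases hv : C.e c v with
        | none =>
          have e0 := te0 c v hv
          cases hu : C.e c (U v) with
          | none => rfl
          | some y =>
            have e1 := teU c hc v
            rw [(heF _ _ _).1 hu, teF] at e1; omega
        | some y =>
          have hy := (heF c v y).1 hv
          rw [hy, (FU1 c hc y).1]
          exact (heF c _ _).2 rfl
      have ht : ∀ y, C.e c v = some y → teS a y = teS a v := by
        intro y hv
        rw [(heF c v y).1 hv, (FU1 c hc y).2]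
      simp only [tensorCS, NData, hc, if_false, hphi, WithBot.bot_add, bot_le, if_true,
        WithBot.bot_lt_coe, key, ite_self]
      cases hv : C.e c v with
      | none => rfl
      | some y => simp [ht y hv]
  · intro c v
    simp only [tensorCS, hep, ← hp]
    by_cases hc : c = a
    · subst hc
      rcases im c with h | h
      · simp only [NData, if_true, if_pos h]
        rw [← WithBot.coe_add, ← WithBot.coe_max]
        congr 1
        rw [epre c _ h, epre c _ h, teFre h v]; rfl
      · simp only [NData, if_true, if_neg (show ¬ A c c = 2 by omega), zero_add]
        rw [← WithBot.coe_max]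
        congr 1
        have := K0 c v
        rw [KUim h] at this
        rw [epim c _ h, epim c _ h]; omega
    · simp [NData, hc, epU c hc]
  · intro c v
    simp only [tensorCS, hphi]
    have e3 := pU c v
    by_cases hc : c = a
    · subst hc
      rcases im c with h | h
      · simp only [NData, if_true, if_pos h, aux_pairing_single]
        rw [← WithBot.coe_add, ← WithBot.coe_max]
        congr 1
        have := teFre h v
        rw [h] at e3 ⊢
        rw [epre c _ h, epre c _ h]; omega
      · simp only [NData, if_true, if_neg (show ¬ A c c = 2 by omega), aux_pairing_single]
        rw [← WithBot.coe_add, ← WithBot.coe_max]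
        congr 1
        have := K0 c v
        rw [KUim h] at this
        rw [epim c _ h, epim c _ h, e3, max_eq_left] <;> linarith
    · simp only [NData, hc, if_false, aux_pairing_single]
      rw [← WithBot.coe_add, max_eq_left bot_le]
      congr 1
      rw [epU c hc, e3]; ring
end

section
/- RC(∞) is closed under the operators e_a (a ∈ I), and the tuple (RC(∞), e_a, f_a, ε_a, φ_a, wt) satisfies all the axioms of an abstract U_q(g)-crystal. -/
/-- A (raw) rigged configuration: for each color `a ∈ I`, a multiset of pairs
`(row length, rigging)`.  Rows of length `0` with rigging `0` are treated implicitly by the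
operators below. -/
abbrev RCraw (I : Type*) := I → Multiset (ℕ × ℤ)

variable {I : Type*} [DecidableEq I]

/-- The empty rigged configuration `(ν_∅, J_∅)`. -/
def emptyRC : RCraw I := fun _ => 0

/-- `|ν^(b)|`, the number of boxes of color `b`. -/
def rcSize (ν : RCraw I) (b : I) : ℤ := ((ν b).map fun p => (p.1 : ℤ)).sum

/-- The vacancy number `p_i^(a) = -∑_b A a b ∑_{rows j of ν^(b)} min i j`. -/
noncomputable def vac (A : I → I → ℤ) (ν : RCraw I) (a : I) (i : ℕ) : ℤ :=
  -∑ᶠ b, A a b * ((ν b).map fun p => (min i p.1 : ℤ)).sum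

/-- The limiting vacancy number `p_∞^(a) = -∑_b A a b |ν^(b)| = ⟨h_a, wt(ν,J)⟩`. -/
noncomputable def pInf (A : I → I → ℤ) (ν : RCraw I) (a : I) : ℤ :=
  -∑ᶠ b, A a b * rcSize ν b

/-- Minimum of a multiset of integers together with `0` (the rigging of the implicit
length-`0` rows). -/
def minWith0 (s : Multiset ℤ) : ℤ := s.fold min 0

/-- Minimum of a nonempty multiset of integers (junk value `0` on the empty multiset). -/
def minPosRows (s : Multiset ℤ) : ℤ := s.fold min (s.fold max 0)

/-- Maximum of a multiset of naturals together with `0`. -/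
def maxWith0 (s : Multiset ℕ) : ℕ := s.fold max 0

/-- Minimum of a nonempty multiset of naturals (junk value on the empty multiset). -/
def minPosRowsN (s : Multiset ℕ) : ℕ := s.fold min (s.fold max 0)

/-- The crystal operator `f_a` on rigged configurations: add a box to a row of maximal
length among the rows of `ν^(a)` whose rigging equals the smallest rigging `x` (with the
length-`0` rows of rigging `0` included), give the new row the rigging `x - A a a / 2`, and
change all other riggings so that the coriggings are preserved. -/
def fOp (A : I → I → ℤ) (a : I) (ν : RCraw I) : RCraw I :=
  let M := ν a
  let x := minWith0 (M.map Prod.snd)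
  let ℓ := maxWith0 ((M.filter fun p => p.2 = x).map Prod.fst)
  fun b =>
    let adj : Multiset (ℕ × ℤ) → Multiset (ℕ × ℤ) :=
      Multiset.map fun p => (p.1, p.2 - if ℓ < p.1 then A b a else 0)
    if b = a then adj (M.erase (ℓ, x)) + {(ℓ + 1, x - A a a / 2)} else adj (ν b)

/-- Auxiliary for `eOp`: remove a box from a row of minimal (positive) length among the
rows of `ν^(a)` with rigging `x`, give it the rigging `x + A a a / 2` (dropping the row if
its length becomes `0`), and change all other riggings so that the coriggings are
preserved. -/
def eRemove (A : I → I → ℤ) (a : I) (ν : RCraw I) (x : ℤ) : RCraw I :=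
  let M := ν a
  let ℓ := minPosRowsN ((M.filter fun p => p.2 = x).map Prod.fst)
  fun b =>
    let adj : Multiset (ℕ × ℤ) → Multiset (ℕ × ℤ) :=
      Multiset.map fun p => (p.1, p.2 + if ℓ ≤ p.1 then A b a else 0)
    if b = a then
      adj (M.erase (ℓ, x)) + (if ℓ = 1 then 0 else {(ℓ - 1, x + A a a / 2)})
    else adj (ν b)

/-- The crystal operator `e_a` on rigged configurations. -/
def eOp (A : I → I → ℤ) (a : I) (ν : RCraw I) : Option (RCraw I) :=
  if A a a = 2 then
    let x := minWith0 ((ν a).map Prod.snd)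
    if x = 0 then none else some (eRemove A a ν x)
  else
    if ν a = 0 ∨ minPosRows ((ν a).map Prod.snd) ≠ -A a a / 2 then none
    else some (eRemove A a ν (-A a a / 2))

/-- The multiset of coriggings `p_i^(a) - x` of the (positive length) rows of `ν^(a)`. -/
noncomputable def corigs (A : I → I → ℤ) (ν : RCraw I) (a : I) : Multiset ℤ :=
  (ν a).map fun p => vac A ν a p.1 - p.2

open scoped Classical in
/-- The star crystal operator `f_a^*`: add a box to a row of maximal length among the rows
of `ν^(a)` whose corigging equals the smallest corigging `x` (with the length-`0` rows of
corigging `0` included), set the rigging of the new row so that its corigging is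
`x - A a a / 2`, and keep all other riggings fixed. -/
noncomputable def fStar (A : I → I → ℤ) (a : I) (ν : RCraw I) : RCraw I :=
  let M := ν a
  let x := minWith0 (corigs A ν a)
  let ℓ := maxWith0 ((M.filter fun p => vac A ν a p.1 - p.2 = x).map Prod.fst)
  fun b =>
    if b = a then
      M.erase (ℓ, vac A ν a ℓ - x) + {(ℓ + 1, (vac A ν a (ℓ + 1) - A a a) - (x - A a a / 2))}
    else ν b

open scoped Classical in
/-- Auxiliary for `eStarOp`: remove a box from a row of minimal (positive) length among
the rows of `ν^(a)` with corigging `x`, set its rigging so that its corigging is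
`x - A a a / 2` (dropping the row if its length becomes `0`), and keep all other riggings
fixed. -/
noncomputable def eStarRemove (A : I → I → ℤ) (a : I) (ν : RCraw I) (x : ℤ) : RCraw I :=
  let M := ν a
  let ℓ := minPosRowsN ((M.filter fun p => vac A ν a p.1 - p.2 = x).map Prod.fst)
  fun b =>
    if b = a then
      M.erase (ℓ, vac A ν a ℓ - x) +
        (if ℓ = 1 then 0 else {(ℓ - 1, vac A ν a (ℓ - 1) - (x - A a a / 2))})
    else ν b

/-- The star crystal operator `e_a^*`. -/
noncomputable def eStarOp (A : I → I → ℤ) (a : I) (ν : RCraw I) : Option (RCraw I) :=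
  if A a a = 2 then
    let x := minWith0 (corigs A ν a)
    if x = 0 then none else some (eStarRemove A a ν x)
  else
    if ν a = 0 ∨ minPosRows (corigs A ν a) ≠ -A a a / 2 then none
    else some (eStarRemove A a ν (-A a a / 2))

/-- `RC(∞)`: the set of rigged configurations generated from the empty rigged
configuration by the operators `e_a`, `f_a`. -/
inductive RCinf (A : I → I → ℤ) : RCraw I → Prop
  | empty : RCinf A emptyRC
  | fstep (a : I) (ν : RCraw I) : RCinf A ν → RCinf A (fOp A a ν)
  | estep (a : I) (ν ν' : RCraw I) : RCinf A ν → eOp A a ν = some ν' → RCinf A ν'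

/-- `RC(∞)^*`: the set of rigged configurations generated from the empty rigged
configuration by the operators `e_a^*`, `f_a^*`. -/
inductive RCinfStar (A : I → I → ℤ) : RCraw I → Prop
  | empty : RCinfStar A emptyRC
  | fstep (a : I) (ν : RCraw I) : RCinfStar A ν → RCinfStar A (fStar A a ν)
  | estep (a : I) (ν ν' : RCraw I) : RCinfStar A ν → eStarOp A a ν = some ν' → RCinfStar A ν'

/-- `tε_a(ν,J) = max {k | e_a^k (ν,J) ≠ 0}`. -/
noncomputable def teRC (A : I → I → ℤ) (a : I) (ν : RCraw I) : ℕ :=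
  sSup {k | iterOpt (eOp A a) k ν ≠ none}

/-- `tε_a^*(ν,J) = max {k | (e_a^*)^k (ν,J) ≠ 0}`. -/
noncomputable def teStarRC (A : I → I → ℤ) (a : I) (ν : RCraw I) : ℕ :=
  sSup {k | iterOpt (eStarOp A a) k ν ≠ none}

/-- `ε_a`: for real `a` the maximal number of applications of `e_a`, for imaginary `a`
zero. -/
noncomputable def epsRC (A : I → I → ℤ) (a : I) (ν : RCraw I) : ℤ :=
  if A a a = 2 then (teRC A a ν : ℤ) else 0

/-- `φ_a(ν,J) = ⟨h_a, wt(ν,J)⟩ + ε_a(ν,J)`. -/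
noncomputable def phiRC (A : I → I → ℤ) (a : I) (ν : RCraw I) : ℤ :=
  pInf A ν a + epsRC A a ν

/-- `ε_a^*`: for real `a` the maximal number of applications of `e_a^*`, for imaginary `a`
zero. -/
noncomputable def epsStarRC (A : I → I → ℤ) (a : I) (ν : RCraw I) : ℤ :=
  if A a a = 2 then (teStarRC A a ν : ℤ) else 0

/-- `φ_a^*(ν,J) = ⟨h_a, wt(ν,J)⟩ + ε_a^*(ν,J)`. -/
noncomputable def phiStarRC (A : I → I → ℤ) (a : I) (ν : RCraw I) : ℤ :=
  pInf A ν a + epsStarRC A a ν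

/-- The weight of a rigged configuration, as the coefficient function of
`-∑_a |ν^(a)| α_a`. -/
def wtRC (ν : RCraw I) : I → ℤ := fun b => -rcSize ν b

/-- For imaginary `a`, `κ_a(ν,J) = tε_a^*(ν,J)·A a a + ⟨h_a, wt(ν,J)⟩`. -/
noncomputable def kappaRC (A : I → I → ℤ) (a : I) (ν : RCraw I) : ℤ :=
  (teStarRC A a ν : ℤ) * A a a + pInf A ν a

/-- For imaginary `a`, `κ_a^*(ν,J) = tε_a(ν,J)·A a a + ⟨h_a, wt(ν,J)⟩`. -/
noncomputable def kappaStarRC (A : I → I → ℤ) (a : I) (ν : RCraw I) : ℤ :=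
  (teRC A a ν : ℤ) * A a a + pInf A ν a



/-- A row, absent when its length is zero. -/
def rowm (l : ℕ) (x : ℤ) : Multiset (ℕ × ℤ) := if l = 0 then 0 else {(l, x)}

/-- Rigging shift caused by `f`. -/
def shf (l : ℕ) (k : ℤ) : Multiset (ℕ × ℤ) → Multiset (ℕ × ℤ) :=
  Multiset.map fun p => (p.1, p.2 - if l < p.1 then k else 0)

/-- Rigging shift caused by `e`. -/
def ushf (l : ℕ) (k : ℤ) : Multiset (ℕ × ℤ) → Multiset (ℕ × ℤ) :=
  Multiset.map fun p => (p.1, p.2 + if l ≤ p.1 then k else 0)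

/-- Replace riggings by coriggings. -/
def cor (P : ℕ → ℤ) : Multiset (ℕ × ℤ) → Multiset (ℕ × ℤ) :=
  Multiset.map fun p => (p.1, P p.1 - p.2)

/-- All rows have positive length. -/
def Pos (M : Multiset (ℕ × ℤ)) : Prop := ∀ p ∈ M, 1 ≤ p.1

/-- The row selected by `f`. -/
structure SelF (M : Multiset (ℕ × ℤ)) (l : ℕ) (x : ℤ) : Prop where
  le0 : x ≤ 0
  le : ∀ p ∈ M, x ≤ p.2
  mem : (l = 0 ∧ x = 0) ∨ (l, x) ∈ M
  max : ∀ p ∈ M, p.2 = x → p.1 ≤ l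

theorem minWith0_le0 (s : Multiset ℤ) : minWith0 s ≤ 0 := by
  unfold minWith0
  induction s using Multiset.induction_on with
  | empty => simp
  | cons a s ih => simp [ih]

theorem minWith0_le (s : Multiset ℤ) : ∀ z ∈ s, minWith0 s ≤ z := by
  unfold minWith0
  induction s using Multiset.induction_on with
  | empty => simp
  | cons a s ih =>
    intro z hz
    rw [Multiset.fold_cons_left]
    rcases Multiset.mem_cons.1 hz with rfl | h
    · exact min_le_left _ _
    · exact (min_le_right _ _).trans (ih z h)

theorem minWith0_mem (s : Multiset ℤ) : minWith0 s = 0 ∨ minWith0 s ∈ s := by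
  unfold minWith0
  induction s using Multiset.induction_on with
  | empty => simp
  | cons a s ih =>
    rw [Multiset.fold_cons_left]
    rcases min_choice a (s.fold min 0) with h | h <;> rw [h]
    · right; simp
    · rcases ih with h | h
      · left; exact h
      · right; simp [h]

theorem foldmax_le {α : Type*} [LinearOrder α] (s : Multiset α) (b : α) :
    ∀ z ∈ s, z ≤ s.fold max b := by
  induction s using Multiset.induction_on with
  | empty => simp
  | cons a s ih =>
    intro z hz
    rw [Multiset.fold_cons_left]
    rcases Multiset.mem_cons.1 hz with rfl | h
    · exact le_max_left _ _
    · exact (ih z h).trans (le_max_right _ _)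

theorem foldmax_mem {α : Type*} [LinearOrder α] (s : Multiset α) (b : α) :
    s.fold max b = b ∨ s.fold max b ∈ s := by
  induction s using Multiset.induction_on with
  | empty => simp
  | cons a s ih =>
    rw [Multiset.fold_cons_left]
    rcases max_choice a (s.fold max b) with h | h <;> rw [h]
    · right; simp
    · rcases ih with h | h
      · left; exact h
      · right; simp [h]

theorem foldmin_le {α : Type*} [LinearOrder α] (s : Multiset α) (b : α) :
    ∀ z ∈ s, s.fold min b ≤ z := by
  induction s using Multiset.induction_on with
  | empty => simp
  | cons a s ih =>
    intro z hz
    rw [Multiset.fold_cons_left]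
    rcases Multiset.mem_cons.1 hz with rfl | h
    · exact min_le_left _ _
    · exact (min_le_right _ _).trans (ih z h)

theorem foldmin_mem {α : Type*} [LinearOrder α] (s : Multiset α) (b : α) :
    s.fold min b = b ∨ s.fold min b ∈ s := by
  induction s using Multiset.induction_on with
  | empty => simp
  | cons a s ih =>
    rw [Multiset.fold_cons_left]
    rcases min_choice a (s.fold min b) with h | h <;> rw [h]
    · right; simp
    · rcases ih with h | h
      · left; exact h
      · right; simp [h]

/-- The double fold used in the definitions computes the minimum. -/
theorem foldmm_eq {α : Type*} [LinearOrder α] (s : Multiset α) (b x : α)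
    (hx : x ∈ s) (hle : ∀ z ∈ s, x ≤ z) : s.fold min (s.fold max b) = x := by
  apply le_antisymm (foldmin_le s _ x hx)
  rcases foldmin_mem s (s.fold max b) with h | h
  · rw [h]; exact foldmax_le s b x hx
  · exact hle _ h

theorem foldmm_mem {α : Type*} [LinearOrder α] (s : Multiset α) (b : α)
    (hs : s ≠ 0) : s.fold min (s.fold max b) ∈ s := by
  obtain ⟨z, hz⟩ := Multiset.exists_mem_of_ne_zero hs
  rcases foldmin_mem s (s.fold max b) with h | h
  · have h1 := foldmin_le s (s.fold max b) z hz
    have h2 := foldmax_le s b z hz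
    rw [h] at h1
    rw [h, le_antisymm h1 h2]; exact hz
  · exact h

theorem selF_exists (M : Multiset (ℕ × ℤ)) :
    SelF M (maxWith0 ((M.filter fun p => p.2 = minWith0 (M.map Prod.snd)).map Prod.fst))
      (minWith0 (M.map Prod.snd)) := by
  set x := minWith0 (M.map Prod.snd) with hx
  have hmax : ∀ p ∈ M, p.2 = x → p.1 ≤ maxWith0 ((M.filter fun p => p.2 = x).map Prod.fst) := by
    intro p hp h
    apply foldmax_le
    exact Multiset.mem_map.2 ⟨p, Multiset.mem_filter.2 ⟨hp, h⟩, rfl⟩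
  have hmem := foldmax_mem ((M.filter fun p => p.2 = x).map Prod.fst) 0
  refine ⟨minWith0_le0 _, fun p hp => minWith0_le _ _ (Multiset.mem_map_of_mem _ hp), ?_, hmax⟩
  have key : maxWith0 ((M.filter fun p => p.2 = x).map Prod.fst) ∈
      ((M.filter fun p => p.2 = x).map Prod.fst) →
      (maxWith0 ((M.filter fun p => p.2 = x).map Prod.fst), x) ∈ M := by
    intro h
    obtain ⟨p, hp, h1⟩ := Multiset.mem_map.1 h
    obtain ⟨hp, h2⟩ := Multiset.mem_filter.1 hp
    rw [← h1, ← h2]; exact hp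
  rcases hmem with h | h
  · by_cases h0 : x = 0
    · exact Or.inl ⟨h, h0⟩
    · right
      rcases minWith0_mem (M.map Prod.snd) with h1 | h1
      · exact absurd h1 h0
      · obtain ⟨p, hp, h2⟩ := Multiset.mem_map.1 h1
        have h3 := hmax p hp h2
        have h4 : p.1 = maxWith0 ((M.filter fun p => p.2 = x).map Prod.fst) := by
          have : maxWith0 ((M.filter fun p => p.2 = x).map Prod.fst) = 0 := h
          omega
        rw [← h4]
        have : (p.1, x) = p := by rw [← hx] at h2; rw [← h2]
        rw [this]; exact hp
  · exact Or.inr (key h)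

theorem SelF.unique {M : Multiset (ℕ × ℤ)} {l l' : ℕ} {x x' : ℤ}
    (h : SelF M l x) (h' : SelF M l' x') : l = l' ∧ x = x' := by
  have hx : x = x' := by
    apply le_antisymm
    · rcases h'.mem with ⟨_, h1⟩ | h1
      · rw [h1]; exact h.le0
      · exact h.le _ h1
    · rcases h.mem with ⟨_, h1⟩ | h1
      · rw [h1]; exact h'.le0
      · exact h'.le _ h1
  subst hx
  refine ⟨?_, rfl⟩
  apply le_antisymm
  · rcases h.mem with ⟨h1, _⟩ | h1
    · omega
    · exact h'.max _ h1 rfl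
  · rcases h'.mem with ⟨h1, _⟩ | h1
    · omega
    · exact h.max _ h1 rfl

/-- Existence of a selection with a prescribed minimum. -/
theorem selF_of_min (M : Multiset (ℕ × ℤ)) (x : ℤ) (h0 : x ≤ 0) (hle : ∀ p ∈ M, x ≤ p.2)
    (hm : x = 0 ∨ ∃ p ∈ M, p.2 = x) : ∃ l, SelF M l x := by
  have h := selF_exists M
  have : minWith0 (M.map Prod.snd) = x := by
    apply le_antisymm
    · rcases hm with h1 | ⟨p, hp, h1⟩
      · rw [h1]; exact h.le0
      · rw [← h1]; exact h.le p hp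
    · rcases h.mem with ⟨_, h1⟩ | h1
      · rw [h1]; exact h0
      · exact hle _ h1
  rw [this] at h
  exact ⟨_, h⟩

theorem rowm_zero (x : ℤ) : rowm 0 x = 0 := by simp [rowm]
theorem rowm_succ (l : ℕ) (x : ℤ) : rowm (l + 1) x = {(l + 1, x)} := by simp [rowm]
theorem rowm_pos {l : ℕ} (h : l ≠ 0) (x : ℤ) : rowm l x = {(l, x)} := by simp [rowm, h]
theorem mem_rowm {l : ℕ} {x : ℤ} {p : ℕ × ℤ} : p ∈ rowm l x ↔ l ≠ 0 ∧ p = (l, x) := by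
  unfold rowm; split_ifs with h <;> simp [h]

theorem shf_add (l : ℕ) (k : ℤ) (M N) : shf l k (M + N) = shf l k M + shf l k N := by simp [shf]
theorem ushf_add (l : ℕ) (k : ℤ) (M N) : ushf l k (M + N) = ushf l k M + ushf l k N := by
  simp [ushf]
theorem cor_add (P : ℕ → ℤ) (M N) : cor P (M + N) = cor P M + cor P N := by simp [cor]
theorem shf_rowm (l : ℕ) (k : ℤ) (m x) :
    shf l k (rowm m x) = rowm m (x - if l < m then k else 0) := by
  unfold rowm; split_ifs <;> simp_all [shf]
theorem cor_rowm (P : ℕ → ℤ) (m x) : cor P (rowm m x) = rowm m (P m - x) := by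
  unfold rowm; split_ifs <;> simp_all [cor]
theorem shf_single (l : ℕ) (k : ℤ) (m x) :
    shf l k {(m, x)} = {(m, x - if l < m then k else 0)} := by simp [shf]
theorem cor_single (P : ℕ → ℤ) (m x) : cor P {(m, x)} = {(m, P m - x)} := by simp [cor]

theorem mem_cor {P : ℕ → ℤ} {M : Multiset (ℕ × ℤ)} {i : ℕ} {z : ℤ} :
    (i, z) ∈ cor P M ↔ (i, P i - z) ∈ M := by
  unfold cor
  simp only [Multiset.mem_map, Prod.mk.injEq, Prod.exists]
  constructor
  · rintro ⟨j, r, h, rfl, rfl⟩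
    simpa using h
  · intro h
    exact ⟨i, _, h, rfl, by ring⟩

theorem cor_cor (P : ℕ → ℤ) (M : Multiset (ℕ × ℤ)) : cor P (cor P M) = M := by
  simp [cor, Multiset.map_map]

theorem pos_cor {P : ℕ → ℤ} {M : Multiset (ℕ × ℤ)} (h : Pos M) : Pos (cor P M) := by
  rintro ⟨i, z⟩ hp
  exact h (i, P i - z) (mem_cor.1 hp)

theorem pos_shf {l : ℕ} {k : ℤ} {M : Multiset (ℕ × ℤ)} (h : Pos M) : Pos (shf l k M) := by
  intro p hp
  obtain ⟨q, hq, rfl⟩ := Multiset.mem_map.1 hp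
  exact h q hq

theorem pos_add {M N : Multiset (ℕ × ℤ)} (h : Pos M) (h' : Pos N) : Pos (M + N) := by
  intro p hp
  rcases Multiset.mem_add.1 hp with h1 | h1
  · exact h p h1
  · exact h' p h1

theorem pos_single (l : ℕ) (x : ℤ) : Pos {(l + 1, x)} := by
  intro p hp
  rw [Multiset.mem_singleton.1 hp]; simp

theorem Pos.right {M N R : Multiset (ℕ × ℤ)} (h : Pos M) (hd : M = N + R) : Pos R := by
  intro p hp; apply h; rw [hd]; exact Multiset.mem_add.2 (Or.inr hp)

theorem cor_shf (P P1 : ℕ → ℤ) (l : ℕ) (k : ℤ) (h : ∀ i, P1 i = P i - if l < i then k else 0)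
    (M : Multiset (ℕ × ℤ)) : cor P1 (shf l k M) = cor P M := by
  simp only [cor, shf, Multiset.map_map]
  apply Multiset.map_congr rfl
  intro p _
  simp [h]

theorem shf_ushf (l : ℕ) (k : ℤ) (M : Multiset (ℕ × ℤ)) : shf l k (ushf (l + 1) k M) = M := by
  simp only [shf, ushf, Multiset.map_map]
  conv_rhs => rw [← Multiset.map_id M]
  apply Multiset.map_congr rfl
  intro p _
  simp

theorem ushf_shf (l : ℕ) (k : ℤ) (M : Multiset (ℕ × ℤ)) : ushf (l + 1) k (shf l k M) = M := by
  simp only [shf, ushf, Multiset.map_map]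
  conv_rhs => rw [← Multiset.map_id M]
  apply Multiset.map_congr rfl
  intro p _
  simp

theorem shf_congr {l l' : ℕ} {k : ℤ} {M : Multiset (ℕ × ℤ)}
    (h : ∀ p ∈ M, k = 0 ∨ (l < p.1 ↔ l' < p.1)) : shf l k M = shf l' k M := by
  apply Multiset.map_congr rfl
  intro p hp
  rcases h p hp with h1 | h1
  · simp [h1]
  · simp [h1]

theorem shf_id {l : ℕ} {k : ℤ} {M : Multiset (ℕ × ℤ)}
    (h : ∀ p ∈ M, k = 0 ∨ p.1 ≤ l) : shf l k M = M := by
  conv_rhs => rw [← Multiset.map_id M]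
  apply Multiset.map_congr rfl
  intro p hp
  rcases h p hp with h1 | h1
  · simp [h1]
  · simp [Nat.not_lt.2 h1]

theorem exists_rest {M : Multiset (ℕ × ℤ)} {l : ℕ} {x : ℤ} (h : (l = 0 ∧ x = 0) ∨ (l, x) ∈ M) : ∃ R, M = rowm l x + R := by
  by_cases h0 : l = 0
  · exact ⟨M, by simp [rowm, h0]⟩
  · rcases h with h | h
    · exact absurd h.1 h0
    · obtain ⟨R, hR⟩ := Multiset.exists_cons_of_mem h
      exact ⟨R, by rw [rowm_pos h0, hR, Multiset.singleton_add]⟩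

theorem erase_rest {M R : Multiset (ℕ × ℤ)} {l : ℕ} {x : ℤ} (hM : Pos M)
    (hR : M = rowm l x + R) : M.erase (l, x) = R := by
  by_cases h0 : l = 0
  · subst h0
    rw [rowm_zero, zero_add] at hR
    rw [← hR]
    apply Multiset.erase_of_notMem
    intro h
    have := hM _ h
    simp at this
  · rw [hR, rowm_pos h0, Multiset.singleton_add, Multiset.erase_cons_head]

theorem fOp_eq (A : I → I → ℤ) (a : I) (ν : RCraw I) {l : ℕ} {x : ℤ} {R : Multiset (ℕ × ℤ)}
    (hM : Pos (ν a)) (hs : SelF (ν a) l x) (hR : ν a = rowm l x + R) :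
    fOp A a ν = fun b => if b = a then shf l (A b a) R + {(l + 1, x - A a a / 2)}
      else shf l (A b a) (ν b) := by
  obtain ⟨h1, h2⟩ := (selF_exists (ν a)).unique hs
  funext b
  unfold fOp
  simp only
  rw [h2] at h1 ⊢
  rw [h1, erase_rest hM hR]
  rfl

theorem fStar_eq (A : I → I → ℤ) (a : I) (ν : RCraw I) {m : ℕ} {y : ℤ} {R : Multiset (ℕ × ℤ)}
    (hM : Pos (ν a)) (hs : SelF (cor (vac A ν a) (ν a)) m y)
    (hR : ν a = rowm m (vac A ν a m - y) + R) :
    fStar A a ν = fun b => if b = a then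
      R + {(m + 1, (vac A ν a (m + 1) - A a a) - (y - A a a / 2))} else ν b := by
  obtain ⟨h1, h2⟩ := (selF_exists (cor (vac A ν a) (ν a))).unique hs
  have e1 : minWith0 (corigs A ν a) = y := by
    rw [← h2]; unfold corigs cor; rw [Multiset.map_map]; rfl
  have e2 : maxWith0 (((ν a).filter fun p => vac A ν a p.1 - p.2 = y).map Prod.fst) = m := by
    rw [← h1, h2]
    unfold cor
    rw [Multiset.filter_map, Multiset.map_map]
    rfl
  funext b
  unfold fStar
  rw [e1]
  have e4 := erase_rest hM hR
  have e5 : ∀ (inst : DecidablePred fun p : ℕ × ℤ => vac A ν a p.1 - p.2 = y),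
      maxWith0 ((@Multiset.filter (ℕ × ℤ) (fun p => vac A ν a p.1 - p.2 = y) inst (ν a)).map
        Prod.fst) = m := by
    intro inst
    convert e2
  rw [e5]
  by_cases hb : b = a
  · simp only [hb, if_true]
    rw [← e4]
  · simp only [hb, if_false]

/-- The row selected by `e`. -/
structure SelE (A : I → I → ℤ) (a : I) (M : Multiset (ℕ × ℤ)) (l : ℕ) (x : ℤ) : Prop where
  le : ∀ p ∈ M, x ≤ p.2
  mem : (l, x) ∈ M
  min : ∀ p ∈ M, p.2 = x → l ≤ p.1
  cond : if A a a = 2 then x < 0 else x = -A a a / 2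

theorem eRemove_eq (A : I → I → ℤ) (a : I) (ν : RCraw I) {l : ℕ} {x : ℤ} {R : Multiset (ℕ × ℤ)}
    (hM : Pos (ν a)) (hs : SelE A a (ν a) l x) (hR : ν a = {(l, x)} + R) :
    eRemove A a ν x = fun b => if b = a then ushf l (A b a) R + rowm (l - 1) (x + A a a / 2)
      else ushf l (A b a) (ν b) := by
  have hl : 1 ≤ l := hM _ hs.mem
  have h1 : minPosRowsN (((ν a).filter fun p => p.2 = x).map Prod.fst) = l := by
    apply foldmm_eq
    · exact Multiset.mem_map.2 ⟨_, Multiset.mem_filter.2 ⟨hs.mem, rfl⟩, rfl⟩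
    · intro z hz
      obtain ⟨p, hp, rfl⟩ := Multiset.mem_map.1 hz
      obtain ⟨hp, h⟩ := Multiset.mem_filter.1 hp
      exact hs.min p hp h
  have h2 : (ν a).erase (l, x) = R := by
    rw [hR, Multiset.singleton_add, Multiset.erase_cons_head]
  funext b
  unfold eRemove
  simp only
  rw [h1, h2]
  have h3 : rowm (l - 1) (x + A a a / 2) = if l = 1 then 0 else {(l - 1, x + A a a / 2)} := by
    unfold rowm
    by_cases h : l = 1
    · simp [h]
    · rw [if_neg h, if_neg (by omega)]
  rw [h3]
  rfl

theorem eOp_eq (A : I → I → ℤ) (a : I) (ν : RCraw I) {l : ℕ} {x : ℤ} {R : Multiset (ℕ × ℤ)}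
    (hM : Pos (ν a)) (hs : SelE A a (ν a) l x) (hR : ν a = {(l, x)} + R) :
    eOp A a ν = some (fun b => if b = a then ushf l (A b a) R + rowm (l - 1) (x + A a a / 2)
      else ushf l (A b a) (ν b)) := by
  rw [← eRemove_eq A a ν hM hs hR]
  unfold eOp
  have hc := hs.cond
  by_cases h1 : A a a = 2
  · rw [if_pos h1] at hc ⊢
    have h3 := minWith0_le _ _ (Multiset.mem_map_of_mem Prod.snd hs.mem)
    have h2 : minWith0 ((ν a).map Prod.snd) ≠ 0 := by
      intro h2
      rw [h2] at h3
      simp only at h3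
      omega
    have : minWith0 ((ν a).map Prod.snd) = x := by
      rcases minWith0_mem ((ν a).map Prod.snd) with h | h
      · exact absurd h h2
      · apply le_antisymm
        · exact h3
        · obtain ⟨p, hp, h3⟩ := Multiset.mem_map.1 h
          rw [← h3]; exact hs.le p hp
    rw [if_neg h2, this]
  · rw [if_neg h1] at hc ⊢
    rw [if_neg, hc]
    rintro (h2 | h2)
    · have := hs.mem; rw [h2] at this; simp at this
    · apply h2
      rw [← hc]
      apply foldmm_eq
      · exact Multiset.mem_map_of_mem Prod.snd hs.mem
      · intro z hz
        obtain ⟨p, hp, rfl⟩ := Multiset.mem_map.1 hz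
        exact hs.le p hp

theorem exists_selE_of_min (A : I → I → ℤ) (a : I) (M : Multiset (ℕ × ℤ)) (x : ℤ)
    (hle : ∀ p ∈ M, x ≤ p.2) (hm : ∃ p ∈ M, p.2 = x)
    (hc : if A a a = 2 then x < 0 else x = -A a a / 2) : ∃ l, SelE A a M l x := by
  have hne : (M.filter fun p => p.2 = x).map Prod.fst ≠ 0 := by
    obtain ⟨p, hp, h⟩ := hm
    intro h0
    have : p.1 ∈ (M.filter fun p => p.2 = x).map Prod.fst :=
      Multiset.mem_map.2 ⟨p, Multiset.mem_filter.2 ⟨hp, h⟩, rfl⟩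
    rw [h0] at this; simp at this
  have h1 := foldmm_mem _ 0 hne
  refine ⟨((M.filter fun p => p.2 = x).map Prod.fst).fold min
      (((M.filter fun p => p.2 = x).map Prod.fst).fold max 0), hle, ?_, ?_, hc⟩
  · obtain ⟨p, hp, h2⟩ := Multiset.mem_map.1 h1
    obtain ⟨hp, h3⟩ := Multiset.mem_filter.1 hp
    rw [← h2, ← h3]
    exact hp
  · intro p hp h
    apply foldmin_le
    exact Multiset.mem_map.2 ⟨p, Multiset.mem_filter.2 ⟨hp, h⟩, rfl⟩

theorem exists_selE (A : I → I → ℤ) (a : I) (ν : RCraw I) {ν' : RCraw I}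
    (h : eOp A a ν = some ν') : ∃ l x, SelE A a (ν a) l x := by
  unfold eOp at h
  by_cases h1 : A a a = 2
  · rw [if_pos h1] at h
    have h2 : minWith0 ((ν a).map Prod.snd) ≠ 0 := by
      intro h2; simp [h2] at h
    refine ⟨_, minWith0 ((ν a).map Prod.snd),
      (exists_selE_of_min A a (ν a) _ ?_ ?_ ?_).choose_spec⟩
    · intro p hp
      exact minWith0_le _ _ (Multiset.mem_map_of_mem Prod.snd hp)
    · rcases minWith0_mem ((ν a).map Prod.snd) with h3 | h3
      · exact absurd h3 h2
      · obtain ⟨p, hp, h3⟩ := Multiset.mem_map.1 h3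
        exact ⟨p, hp, h3⟩
    · rw [if_pos h1]
      have := minWith0_le0 ((ν a).map Prod.snd)
      omega
  · rw [if_neg h1] at h
    have h2 : ¬ (ν a = 0 ∨ minPosRows ((ν a).map Prod.snd) ≠ -A a a / 2) := by
      intro h2; simp [if_pos h2] at h
    push Not at h2
    obtain ⟨h2, h3⟩ := h2
    refine ⟨_, -A a a / 2,
      (exists_selE_of_min A a (ν a) _ ?_ ?_ ?_).choose_spec⟩
    · intro p hp
      rw [← h3]
      exact foldmin_le _ _ _ (Multiset.mem_map_of_mem Prod.snd hp)
    · have := foldmm_mem ((ν a).map Prod.snd) 0 (by simpa using h2)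
      obtain ⟨p, hp, h4⟩ := Multiset.mem_map.1 this
      exact ⟨p, hp, by rw [h4]; exact h3⟩
    · rw [if_neg h1]


/-- Finite support. -/
def FinS (ν : RCraw I) : Prop := {b | ν b ≠ 0}.Finite

/-- Sum of truncated row lengths. -/
def msum (i : ℕ) (M : Multiset (ℕ × ℤ)) : ℤ := (M.map fun p => (min i p.1 : ℤ)).sum

/-- Number of rows of a given length. -/
def cnt (j : ℕ) (M : Multiset (ℕ × ℤ)) : ℤ := (M.countP (fun p => p.1 = j) : ℤ)

theorem msum_add (i M N) : msum i (M + N) = msum i M + msum i N := by simp [msum]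
theorem msum_shf (i l k M) : msum i (shf l k M) = msum i M := by
  simp [msum, shf, Multiset.map_map]
theorem msum_single (i l x) : msum i {(l, x)} = min (i : ℤ) l := by simp [msum]
theorem msum_rowm (i l x) : msum i (rowm l x) = min (i : ℤ) l := by
  unfold rowm; split_ifs with h <;> simp [msum, h]

theorem cnt_nonneg (j M) : 0 ≤ cnt j M := by unfold cnt; positivity
theorem cnt_zero {j M} (h : ∀ p ∈ M, p.1 ≠ j) : cnt j M = 0 := by
  unfold cnt
  rw [Multiset.countP_eq_zero.2 h]; rfl
theorem cnt_pos {j M} {p : ℕ × ℤ} (h : p ∈ M) (hj : p.1 = j) : 1 ≤ cnt j M := by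
  unfold cnt
  have : 0 < M.countP (fun p => p.1 = j) := Multiset.countP_pos.2 ⟨p, h, hj⟩
  omega
theorem cnt_add (j M N) : cnt j (M + N) = cnt j M + cnt j N := by simp [cnt]
theorem cnt_single (j x) : cnt j {(j, x)} = 1 := by
  simp [cnt, ← Multiset.cons_zero, Multiset.countP_cons_of_pos]
theorem cnt_cor (P j M) : cnt j (cor P M) = cnt j M := by
  unfold cnt cor
  rw [Multiset.countP_map, Multiset.countP_eq_card_filter]

theorem msum_diff (i : ℕ) (M : Multiset (ℕ × ℤ)) :
    msum (i + 2) M + msum i M - 2 * msum (i + 1) M = - cnt (i + 1) M := by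
  induction M using Multiset.induction_on with
  | empty => simp [msum, cnt]
  | cons p M ih =>
    have h : ∀ j, msum j (p ::ₘ M) = min (j : ℤ) p.1 + msum j M := by intro j; simp [msum]
    have h2 : cnt (i + 1) (p ::ₘ M) = cnt (i + 1) M + if p.1 = i + 1 then 1 else 0 := by
      unfold cnt
      rw [Multiset.countP_cons]
      push_cast
      rfl
    rw [h, h, h, h2]
    push_cast
    split_ifs with hp <;> omega

theorem vac_eq_sum (A : I → I → ℤ) {ν : RCraw I} {S : Finset I} (hS : ∀ b, ν b ≠ 0 → b ∈ S)
    (a : I) (i : ℕ) : vac A ν a i = -∑ b ∈ S, A a b * msum i (ν b) := by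
  unfold vac
  rw [finsum_eq_sum_of_support_subset]
  · rfl
  · intro b hb
    apply hS
    intro h
    apply hb
    simp [h]

theorem pInf_eq_sum (A : I → I → ℤ) {ν : RCraw I} {S : Finset I} (hS : ∀ b, ν b ≠ 0 → b ∈ S)
    (a : I) : pInf A ν a = -∑ b ∈ S, A a b * rcSize ν b := by
  unfold pInf
  rw [finsum_eq_sum_of_support_subset]
  intro b hb
  apply hS
  intro h
  apply hb
  simp [h, rcSize]

theorem FinS.exists {ν : RCraw I} (h : FinS ν) (a : I) :
    ∃ S : Finset I, a ∈ S ∧ ∀ b, ν b ≠ 0 → b ∈ S :=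
  ⟨insert a h.toFinset, by simp, fun b hb => by
    rw [Finset.mem_insert]; right; exact h.mem_toFinset.2 hb⟩

theorem vac_update (A : I → I → ℤ) {ν ν' : RCraw I} (h : FinS ν) (h' : FinS ν') (a : I) (l : ℕ)
    (hm : ∀ i b, msum i (ν' b) = msum i (ν b) + if b = a then (if l < i then 1 else 0) else 0)
    (b : I) (i : ℕ) : vac A ν' b i = vac A ν b i - if l < i then A b a else 0 := by
  obtain ⟨S, ha, hS⟩ := h.exists a
  obtain ⟨S', _, hS'⟩ := h'.exists a
  rw [vac_eq_sum A (S := S ∪ S') (fun b hb => Finset.mem_union_left _ (hS b hb)),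
    vac_eq_sum A (S := S ∪ S') (fun b hb => Finset.mem_union_right _ (hS' b hb))]
  have : ∀ c ∈ S ∪ S', A b c * msum i (ν' c) = A b c * msum i (ν c) +
      if c = a then (if l < i then A b a else 0) else 0 := by
    intro c _
    rw [hm, mul_add]
    split_ifs with h1 h2
    · subst h1; ring
    · ring
    · ring
  rw [Finset.sum_congr rfl this, Finset.sum_add_distrib, Finset.sum_ite_eq' ,
    if_pos (Finset.mem_union_left _ ha)]
  ring

/-- Structure of the vacancy numbers of one color: `M` the rows, `P` the vacancy numbers, `n` the
contribution of the other colors to the second difference. -/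
structure Cfg (h : ℤ) (M : Multiset (ℕ × ℤ)) (P n : ℕ → ℤ) (pinf : ℤ) : Prop where
  pos : Pos M
  n0 : ∀ j, 0 ≤ n j
  diff : ∀ i, P (i + 2) + P i - 2 * P (i + 1) = 2 * h * cnt (i + 1) M - n (i + 1)
  P0 : P 0 = 0
  ev : ∃ L, ∀ i, L ≤ i → P i = pinf

theorem Cfg.dual {h : ℤ} {M : Multiset (ℕ × ℤ)} {P n : ℕ → ℤ} {q : ℤ} (c : Cfg h M P n q) :
    Cfg h (cor P M) P n q :=
  ⟨pos_cor c.pos, c.n0, fun i => by rw [cnt_cor]; exact c.diff i, c.P0, c.ev⟩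

theorem exists_bound (M : Multiset (ℕ × ℤ)) : ∃ L : ℕ, ∀ i, L ≤ i →
    msum i M = (M.map fun p => (p.1 : ℤ)).sum := by
  induction M using Multiset.induction_on with
  | empty => exact ⟨0, fun i _ => by simp [msum]⟩
  | cons p M ih =>
    obtain ⟨L, hL⟩ := ih
    refine ⟨max L p.1, fun i hi => ?_⟩
    have := hL i (le_trans (le_max_left _ _) hi)
    have h2 : p.1 ≤ i := le_trans (le_max_right _ _) hi
    have h1 : msum i (p ::ₘ M) = min (i : ℤ) p.1 + msum i M := by simp [msum]
    rw [h1, this]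
    simp
    omega

theorem exists_bound_fin (ν : RCraw I) (S : Finset I) : ∃ L : ℕ, ∀ i, L ≤ i →
    ∀ b ∈ S, msum i (ν b) = rcSize ν b := by
  induction S using Finset.induction_on with
  | empty => exact ⟨0, by simp⟩
  | insert c S _ ih =>
    obtain ⟨L, hL⟩ := ih
    obtain ⟨L', hL'⟩ := exists_bound (ν c)
    refine ⟨max L L', fun i hi b hb => ?_⟩
    rcases Finset.mem_insert.1 hb with rfl | hb
    · exact hL' i (le_trans (le_max_right _ _) hi)
    · exact hL i (le_trans (le_max_left _ _) hi) b hb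

theorem exists_cfg {A : I → I → ℤ} (hA : IsBorcherdsCartan A) {ν : RCraw I} (hf : FinS ν) (a : I)
    (hpos : Pos (ν a)) {h : ℤ} (hh : A a a = 2 * h) :
    ∃ n : ℕ → ℤ, Cfg h (ν a) (vac A ν a) n (pInf A ν a) ∧
      ∀ j, n j = 0 → ∀ b, b ≠ a → ∀ p ∈ ν b, p.1 = j → A b a = 0 := by
  obtain ⟨S, ha, hS⟩ := hf.exists a
  refine ⟨fun j => ∑ b ∈ S, if b = a then 0 else (-A a b) * cnt j (ν b), ?_, ?_⟩
  · have hn : ∀ j, ∀ b ∈ S, 0 ≤ if b = a then 0 else (-A a b) * cnt j (ν b) := by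
      intro j b _
      split_ifs with hb
      · exact le_rfl
      · have := hA.offdiag a b (Ne.symm hb)
        exact mul_nonneg (by omega) (cnt_nonneg _ _)
    refine ⟨hpos, fun j => Finset.sum_nonneg (hn j), ?_, ?_, ?_⟩
    · intro i
      have e : 2 * h * cnt (i + 1) (ν a) =
          ∑ b ∈ S, if b = a then 2 * h * cnt (i + 1) (ν a) else 0 := by
        rw [Finset.sum_ite_eq', if_pos ha]
      rw [vac_eq_sum A hS, vac_eq_sum A hS, vac_eq_sum A hS, e, ← Finset.sum_sub_distrib,
        mul_neg, Finset.mul_sum, sub_neg_eq_add, ← Finset.sum_neg_distrib,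
        ← Finset.sum_neg_distrib, ← Finset.sum_add_distrib, ← Finset.sum_add_distrib]
      apply Finset.sum_congr rfl
      intro b _
      have := msum_diff i (ν b)
      split_ifs with hb
      · subst hb
        rw [hh]
        linear_combination (-2 * h) * this
      · linear_combination (-A a b) * this
    · rw [vac_eq_sum A hS]
      have : ∀ M : Multiset (ℕ × ℤ), msum 0 M = 0 := by
        intro M
        simp [msum]
      simp [this]
    · obtain ⟨L, hL⟩ := exists_bound_fin ν S
      refine ⟨L, fun i hi => ?_⟩
      rw [vac_eq_sum A hS, pInf_eq_sum A hS]
      congr 1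
      exact Finset.sum_congr rfl fun b hb => by rw [hL i hi b hb]
  · intro j hj b hb p hp hpj
    have hbS : b ∈ S := hS b (by intro h0; rw [h0] at hp; simp at hp)
    have hn : ∀ b ∈ S, 0 ≤ if b = a then 0 else (-A a b) * cnt j (ν b) := by
      intro b _
      split_ifs with hb
      · exact le_rfl
      · have := hA.offdiag a b (Ne.symm hb)
        exact mul_nonneg (by omega) (cnt_nonneg _ _)
    have h1 := (Finset.sum_eq_zero_iff_of_nonneg hn).1 hj b hbS
    rw [if_neg hb] at h1
    have h2 := cnt_pos hp hpj
    rw [← hA.zero_iff]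
    rcases mul_eq_zero.1 h1 with h3 | h3
    · omega
    · omega


theorem right_aux (Q : ℕ → ℤ) (l : ℕ) (t : ℤ) (h1 : Q (l + 1) ≤ Q l) (h2 : Q (l + 1) ≤ t)
    (h3 : ∀ k, Q (l + k + 1) ≤ t → Q (l + k + 2) + Q (l + k) ≤ 2 * Q (l + k + 1)) (k : ℕ) :
    Q (l + k + 1) - Q (l + k) ≤ Q (l + 1) - Q l ∧ Q (l + k + 1) ≤ t := by
  induction k with
  | zero => exact ⟨le_rfl, h2⟩
  | succ k ih =>
    have := h3 k ih.2
    rw [show l + (k + 1) + 1 = l + k + 2 from by ring, show l + (k + 1) = l + k + 1 from by ring]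
    constructor <;> linarith [ih.1, ih.2]

theorem Cfg.no_row {h : ℤ} {M : Multiset (ℕ × ℤ)} {P n : ℕ → ℤ} {q : ℤ} (c : Cfg h M P n q)
    {i : ℕ} (hi : ∀ p ∈ M, p.1 ≠ i + 1) :
    P (i + 2) + P i - 2 * P (i + 1) = - n (i + 1) := by
  rw [c.diff, cnt_zero hi]; ring

theorem Cfg.right {M : Multiset (ℕ × ℤ)} {P n : ℕ → ℤ} {q : ℤ} {h : ℤ} (c : Cfg h M P n q)
    {l : ℕ} {s : ℤ} (h1 : s ≤ P l) (h2 : ∀ p ∈ M, l < p.1 → s < P p.1) (hq : s + 1 ≤ q) :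
    s + 1 ≤ P (l + 1) := by
  by_contra hc
  obtain ⟨L, hL⟩ := c.ev
  have := (right_aux P l s (by omega) (by omega) (fun k hk => by
    have := c.no_row (i := l + k) (fun p hp he => by
      have := h2 p hp (by omega)
      rw [he] at this; omega)
    have := c.n0 (l + k + 1)
    omega) L).2
  rw [hL _ (by omega)] at this
  omega

theorem Cfg.tail {M : Multiset (ℕ × ℤ)} {P n : ℕ → ℤ} {q : ℤ} {h : ℤ} (c : Cfg h M P n q)
    {l : ℕ} {s : ℤ} (h1 : s ≤ P l) (h2 : ∀ p ∈ M, l < p.1 → s < P p.1) (hq : q ≤ s) :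
    (∀ i, l ≤ i → P i = s) ∧ (∀ i, l < i → n i = 0) ∧ (∀ p ∈ M, p.1 ≤ l) := by
  obtain ⟨L, hL⟩ := c.ev
  have key : ∀ j i, l ≤ i → L ≤ i + j → P i ≤ s ∧ P i ≤ P (i + 1) := by
    intro j
    induction j with
    | zero =>
      intro i _ hi
      rw [hL i (by omega), hL (i + 1) (by omega)]
      exact ⟨hq, le_rfl⟩
    | succ j ih =>
      intro i hi hj
      obtain ⟨h3, h4⟩ := ih (i + 1) (by omega) (by omega)
      have := c.no_row (i := i) (fun p hp he => by
        have := h2 p hp (by omega)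
        rw [he] at this; omega)
      have := c.n0 (i + 1)
      rw [show i + 1 + 1 = i + 2 from rfl] at h4
      constructor <;> omega
  have hP : ∀ i, l ≤ i → P i = s := by
    intro i hi
    induction i, hi using Nat.le_induction with
    | base => have := (key L l le_rfl (by omega)).1; omega
    | succ i hi ih =>
      have := (key L i hi (by omega)).2
      have := (key L (i + 1) (by omega) (by omega)).1
      omega
  have hM : ∀ p ∈ M, p.1 ≤ l := by
    intro p hp
    by_contra hc
    have := h2 p hp (by omega)
    rw [hP _ (by omega)] at this
    omega
  refine ⟨hP, ?_, hM⟩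
  intro i hi
  obtain ⟨j, rfl⟩ : ∃ j, i = j + 1 := ⟨i - 1, by omega⟩
  have := c.no_row (i := j) (fun p hp he => by have := hM p hp; omega)
  rw [hP _ (by omega), hP _ (by omega), hP _ (by omega)] at this
  omega

theorem Cfg.left {M : Multiset (ℕ × ℤ)} {P n : ℕ → ℤ} {q : ℤ} {h : ℤ} (c : Cfg h M P n q)
    {l : ℕ} {s : ℤ} (h0 : s ≤ 0) (h1 : P (l + 1) = s) (h2 : ∀ p ∈ M, s ≤ P p.1) : s ≤ P l := by
  by_contra hc
  have key : ∀ i, i ≤ l → P i < s ∧ P i < P (i + 1) := by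
    intro i hi
    induction hi using Nat.decreasingInduction with
    | self => constructor <;> omega
    | of_succ i hi ih =>
      have := c.no_row (i := i) (fun p hp he => by
        have := h2 p hp
        rw [he] at this; omega)
      have := c.n0 (i + 1)
      rw [show i + 1 + 1 = i + 2 from rfl] at ih
      constructor <;> omega
  have := (key 0 (by omega)).1
  rw [c.P0] at this
  omega

theorem Cfg.left_const {M : Multiset (ℕ × ℤ)} {P n : ℕ → ℤ} {q : ℤ} {h : ℤ} (c : Cfg h M P n q)
    {l : ℕ} {s : ℤ} (h0 : s ≤ 0) (h1 : P (l + 1) = s) (h2 : ∀ p ∈ M, s ≤ P p.1) (h3 : P l = s) :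
    ∃ i, i ≤ l ∧ (i = 0 ∨ ∃ p ∈ M, p.1 = i) ∧ (∀ k, i ≤ k → k ≤ l → P k = s) ∧
      (∀ p ∈ M, i < p.1 → l < p.1) ∧ (∀ k, i < k → k ≤ l → n k = 0) := by
  classical
  obtain ⟨i, hil, hi, hmax⟩ : ∃ i, i ≤ l ∧ (i = 0 ∨ ∃ p ∈ M, p.1 = i) ∧
      ∀ p ∈ M, i < p.1 → l < p.1 := by
    refine ⟨Nat.findGreatest (fun i => i = 0 ∨ ∃ p ∈ M, p.1 = i) l, Nat.findGreatest_le _, ?_, ?_⟩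
    · exact Nat.findGreatest_spec (P := fun i => i = 0 ∨ ∃ p ∈ M, p.1 = i) (Nat.zero_le l)
        (Or.inl rfl)
    · intro p hp hlt
      by_contra hc
      exact Nat.findGreatest_is_greatest hlt (by omega) (Or.inr ⟨p, hp, rfl⟩)
  have key : ∀ k, k ≤ l → i ≤ k → P k ≤ s ∧ P k ≤ P (k + 1) := by
    intro k hk
    induction hk using Nat.decreasingInduction with
    | self => intro _; constructor <;> omega
    | of_succ k hk ih =>
      intro hik
      have ih := ih (by omega)
      have := c.no_row (i := k) (fun p hp he => by
        have := hmax p hp (by omega)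
        omega)
      have := c.n0 (k + 1)
      rw [show k + 1 + 1 = k + 2 from rfl] at ih
      constructor <;> omega
  have hPi : s ≤ P i := by
    rcases hi with hi | ⟨p, hp, hi⟩
    · rw [hi, c.P0]; exact h0
    · rw [← hi]; exact h2 p hp
  have hP : ∀ k, i ≤ k → k ≤ l → P k = s := by
    intro k hk
    induction k, hk using Nat.le_induction with
    | base => intro h; have := (key i hil le_rfl).1; omega
    | succ k hk ih =>
      intro h
      have := ih (by omega)
      have := (key k (by omega) hk).2
      have := (key (k + 1) h (by omega)).1
      omega
  refine ⟨i, hil, hi, hP, hmax, ?_⟩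
  intro k hk hkl
  obtain ⟨j, rfl⟩ : ∃ j, k = j + 1 := ⟨k - 1, by omega⟩
  have e := c.no_row (i := j) (fun p hp he => by have := hmax p hp (by omega); omega)
  have e1 := hP j (by omega) (by omega)
  have e2 := hP (j + 1) (by omega) (by omega)
  have e3 : P (j + 2) = s := by
    by_cases hj : j + 1 = l
    · rw [← hj] at h1; exact h1
    · exact hP (j + 2) (by omega) (by omega)
  omega

/-- Basic inequalities. -/
theorem sel_facts {M : Multiset (ℕ × ℤ)} {P : ℕ → ℤ} {l m : ℕ} {x y : ℤ} (h0 : P 0 = 0)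
    (hf : SelF M l x) (hs : SelF (cor P M) m y) :
    (∀ p ∈ M, x ≤ p.2 ∧ y ≤ P p.1 - p.2 ∧ (p.2 = x → p.1 ≤ l) ∧ (P p.1 - p.2 = y → p.1 ≤ m)) ∧
    x + y ≤ P l ∧ x + y ≤ P m := by
  have key : ∀ p ∈ M, x ≤ p.2 ∧ y ≤ P p.1 - p.2 ∧ (p.2 = x → p.1 ≤ l) ∧
      (P p.1 - p.2 = y → p.1 ≤ m) := by
    intro p hp
    have hp' : (p.1, P p.1 - p.2) ∈ cor P M := by rw [mem_cor]; simpa using hp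
    exact ⟨hf.le p hp, hs.le _ hp', hf.max p hp, hs.max _ hp'⟩
  refine ⟨key, ?_, ?_⟩
  · rcases hf.mem with ⟨rfl, rfl⟩ | h
    · rw [h0]; linarith [hs.le0]
    · have := (key _ h).2.1; simp only at this; linarith
  · rcases hs.mem with ⟨rfl, rfl⟩ | h
    · rw [h0]; linarith [hf.le0]
    · have := (key _ (mem_cor.1 h)).1; simp only at this; linarith

/-- After `f` in the case `κ ≥ 1` the minimal corigging is unchanged. -/
theorem attained {M R : Multiset (ℕ × ℤ)} {P n : ℕ → ℤ} {q : ℤ} (c : Cfg 1 M P n q)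
    {l m : ℕ} {x y : ℤ} (hf : SelF M l x) (hs : SelF (cor P M) m y) (hq : x + y + 1 ≤ q)
    (hR : M = rowm l x + R) :
    ∃ m', SelF (cor P R + {(l + 1, P (l + 1) - x - 1)}) m' y := by
  obtain ⟨key, hl, hm⟩ := sel_facts c.P0 hf hs
  have hP1 : x + y + 1 ≤ P (l + 1) := c.right hl (fun p hp hlt => by
    obtain ⟨h1, h2, h3, h4⟩ := key p hp
    by_contra hc
    have := h3 (by omega)
    omega) hq
  have hRM : ∀ p ∈ R, p ∈ M := fun p hp => by rw [hR]; exact Multiset.mem_add.2 (Or.inr hp)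
  have hle : ∀ p ∈ cor P R + {(l + 1, P (l + 1) - x - 1)}, y ≤ p.2 := by
    rintro ⟨i, z⟩ hp
    rcases Multiset.mem_add.1 hp with h | h
    · have := (key _ (hRM _ (mem_cor.1 h))).2.1
      simp only at this ⊢; linarith
    · simp only [Multiset.mem_singleton, Prod.mk.injEq] at h
      simp only; omega
  apply selF_of_min _ _ hs.le0 hle
  rcases hs.mem with ⟨_, h⟩ | h
  · exact Or.inl h
  rw [mem_cor, hR, Multiset.mem_add, mem_rowm] at h
  rcases h with ⟨hl0, he⟩ | h
  · simp only [Prod.mk.injEq] at he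
    obtain ⟨hml, hx⟩ := he
    subst hml
    by_cases hin : (m, x) ∈ R
    · right
      refine ⟨(m, y), Multiset.mem_add.2 (Or.inl (mem_cor.2 ?_)), rfl⟩
      rw [hx]; exact hin
    obtain ⟨l, rfl⟩ : ∃ l, m = l + 1 := ⟨m - 1, by omega⟩
    have hge : ∀ p ∈ M, x + y ≤ P p.1 := fun p hp => by
      obtain ⟨h1, h2, _, _⟩ := key p hp; linarith
    have hPl : P (l + 1) = x + y := by linarith
    have hxy : x + y ≤ 0 := by linarith [hf.le0, hs.le0]
    have hleft := c.left hxy hPl hge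
    have hcnt : cnt (l + 1) M = 1 := by
      rw [hR, rowm_succ, cnt_add, cnt_single, cnt_zero, add_zero]
      intro p hp he
      obtain ⟨h1, h2, h3, h4⟩ := key p (hRM p hp)
      rw [he] at h2
      apply hin
      have : p = (l + 1, x) := by
        apply Prod.ext
        · exact he
        · simp only; omega
      rw [← this]; exact hp
    have hdiff := c.diff l
    rw [hcnt] at hdiff
    have hn := c.n0 (l + 1)
    rw [show l + 1 + 1 = l + 2 from rfl] at *
    by_cases h1 : P (l + 2) = x + y + 1
    · right
      refine ⟨(l + 2, P (l + 2) - x - 1), Multiset.mem_add.2 (Or.inr (by simp)), ?_⟩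
      simp only; omega
    · obtain ⟨i, hil, hi, hPi, hno, _⟩ := c.left_const hxy hPl hge (by omega)
      have hPi0 := hPi i le_rfl hil
      rcases hi with hi | ⟨p, hp, hi⟩
      · left
        rw [hi, c.P0] at hPi0
        linarith [hf.le0, hs.le0]
      · right
        have hpR : p ∈ R := by
          rw [hR, rowm_succ, Multiset.mem_add, Multiset.mem_singleton] at hp
          rcases hp with hp | hp
          · exfalso
            rw [hp] at hi; simp only at hi; omega
          · exact hp
        obtain ⟨h1, h2, h3, h4⟩ := key p hp
        refine ⟨(p.1, P p.1 - p.2), Multiset.mem_add.2 (Or.inl (mem_cor.2 ?_)), ?_⟩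
        · simpa using hpR
        · simp only
          rw [hi] at h2 ⊢
          omega
  · right
    exact ⟨(m, y), Multiset.mem_add.2 (Or.inl (mem_cor.2 h)), rfl⟩

theorem s1core {M : Multiset (ℕ × ℤ)} {P n : ℕ → ℤ} {q : ℤ} (c : Cfg 1 M P n q)
    {l m : ℕ} {x y : ℤ} (hf : SelF M l x) (hs : SelF (cor P M) m y) (hq : x + y + 2 ≤ q)
    (h1 : P (l + 1) = x + y + 1) (hml : m ≤ l) :
    m = l ∧ P l = x + y ∧ P (l + 2) = x + y + 2 ∧ n (l + 1) = 0 ∧ ∀ p ∈ M, p.1 ≠ l + 1 := by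
  obtain ⟨key, hl, hm⟩ := sel_facts c.P0 hf hs
  have hgt : ∀ p ∈ M, l < p.1 → x + y + 1 < P p.1 := by
    intro p hp hlt
    obtain ⟨a1, a2, a3, a4⟩ := key p hp
    by_contra hc
    by_cases hx : p.2 = x
    · have := a3 hx; omega
    · by_cases hy : P p.1 - p.2 = y
      · have := a4 hy; omega
      · omega
  have hPl : P l = x + y := by
    by_contra hc
    have := c.right (l := l) (s := x + y + 1) (by omega) hgt (by omega)
    omega
  have hm' : m = l := by
    rcases hf.mem with ⟨h, _⟩ | h
    · omega
    · have := (key _ h).2.2.2 (by simp only; omega)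
      simp only at this; omega
  have hno : ∀ p ∈ M, p.1 ≠ l + 1 := by
    intro p hp he
    have := hgt p hp (by omega)
    rw [he] at this; omega
  have h2 := c.right (l := l + 1) (s := x + y + 1) (by omega)
    (fun p hp hlt => hgt p hp (by omega)) (by omega)
  rw [show l + 1 + 1 = l + 2 from rfl] at h2
  have h3 := c.no_row hno
  have h4 := c.n0 (l + 1)
  exact ⟨hm', hPl, by omega, by omega, hno⟩

theorem trichotomy {M : Multiset (ℕ × ℤ)} {P n : ℕ → ℤ} {q : ℤ} (c : Cfg 1 M P n q)
    {l m : ℕ} {x y : ℤ} (hf : SelF M l x) (hs : SelF (cor P M) m y) (hq : x + y + 2 ≤ q) :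
    (∃ R, M = rowm l x + rowm m (P m - y) + R ∧
      SelF (cor P (rowm m (P m - y) + R) + {(l + 1, P (l + 1) - x - 1)}) m y ∧
      SelF (rowm l x + R + {(m + 1, P (m + 1) - y - 1)}) l x) ∨
    (m = l ∧ P l = x + y ∧ P (l + 1) = x + y + 1 ∧ P (l + 2) = x + y + 2 ∧ n (l + 1) = 0 ∧
      ∃ R, M = rowm l x + R ∧ (∀ p ∈ R, p.1 ≠ l + 1) ∧
      SelF (cor P R + {(l + 1, P (l + 1) - x - 1)}) (l + 1) y ∧
      SelF (R + {(l + 1, P (l + 1) - y - 1)}) (l + 1) x) ∨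
    (m = l ∧ P l = x + y ∧ P (l + 1) = x + y + 2 ∧ ∃ i, i < l ∧ P i = x + y ∧ P (i + 1) = x + y ∧
      (∀ k, i < k → k ≤ l → n k = 0) ∧
      ∃ R, M = rowm l x + rowm i x + R ∧ (∀ p ∈ R, i < p.1 → l < p.1) ∧
      SelF (cor P (rowm i x + R) + {(l + 1, P (l + 1) - x - 1)}) i y ∧
      SelF (rowm i x + R + {(l + 1, P (l + 1) - y - 1)}) i x) := by
  obtain ⟨key, hl, hm⟩ := sel_facts c.P0 hf hs
  have hPl1 : x + y + 1 ≤ P (l + 1) := c.right hl (fun p hp hlt => by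
    obtain ⟨h1, h2, h3, h4⟩ := key p hp
    by_contra hc
    have := h3 (by omega)
    omega) (by omega)
  have hPm1 : x + y + 1 ≤ P (m + 1) := c.right hm (fun p hp hlt => by
    obtain ⟨h1, h2, h3, h4⟩ := key p hp
    by_contra hc
    have := h4 (by omega)
    omega) (by omega)
  by_cases e1 : P (l + 1) = x + y + 1 ∧ m ≤ l
  · right; left
    obtain ⟨hm', hPl, hP2, hn, hno⟩ := s1core c hf hs hq e1.1 e1.2
    obtain ⟨R, hR⟩ := exists_rest hf.mem
    have hRM : ∀ p ∈ R, p ∈ M := fun p hp => by rw [hR]; exact Multiset.mem_add.2 (Or.inr hp)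
    refine ⟨hm', hPl, e1.1, hP2, hn, R, hR, fun p hp => hno p (hRM p hp), ?_, ?_⟩
    · refine ⟨hs.le0, ?_, Or.inr (Multiset.mem_add.2 (Or.inr ?_)), ?_⟩
      · rintro ⟨i, z⟩ hp
        rcases Multiset.mem_add.1 hp with h | h
        · have := (key _ (hRM _ (mem_cor.1 h))).2.1
          simp only at this ⊢; linarith
        · simp only [Multiset.mem_singleton, Prod.mk.injEq] at h
          simp only; omega
      · rw [Multiset.mem_singleton, Prod.mk.injEq]; exact ⟨rfl, by omega⟩
      · rintro ⟨i, z⟩ hp hz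
        rcases Multiset.mem_add.1 hp with h | h
        · have := (key _ (hRM _ (mem_cor.1 h))).2.2.2
          simp only at this hz ⊢
          have := this (by linarith)
          omega
        · simp only [Multiset.mem_singleton, Prod.mk.injEq] at h
          simp only; omega
    · refine ⟨hf.le0, ?_, Or.inr (Multiset.mem_add.2 (Or.inr ?_)), ?_⟩
      · rintro ⟨i, z⟩ hp
        rcases Multiset.mem_add.1 hp with h | h
        · exact (key _ (hRM _ h)).1
        · simp only [Multiset.mem_singleton, Prod.mk.injEq] at h
          simp only; omega
      · rw [Multiset.mem_singleton, Prod.mk.injEq]; exact ⟨rfl, by omega⟩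
      · rintro ⟨i, z⟩ hp hz
        rcases Multiset.mem_add.1 hp with h | h
        · have := (key _ (hRM _ h)).2.2.1 hz
          simp only at this ⊢
          omega
        · simp only [Multiset.mem_singleton, Prod.mk.injEq] at h
          simp only; omega
  have e2 : ¬ (P (m + 1) = x + y + 1 ∧ l ≤ m) := by
    rintro ⟨h1, h2⟩
    have := s1core (l := m) (m := l) (x := y) (y := x) c.dual hs
      (by rw [cor_cor]; exact hf) (by omega) (by omega) h2
    apply e1
    rw [this.1]
    exact ⟨h1, le_rfl⟩
  by_cases hd : ∃ R, M = rowm l x + rowm m (P m - y) + R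
  · left
    obtain ⟨R, hR⟩ := hd
    have hRM : ∀ p ∈ rowm m (P m - y) + R, p ∈ M := fun p hp => by
      rw [hR, add_assoc]; exact Multiset.mem_add.2 (Or.inr hp)
    have hRM' : ∀ p ∈ rowm l x + R, p ∈ M := fun p hp => by
      rw [hR, add_right_comm]; exact Multiset.mem_add.2 (Or.inl hp)
    refine ⟨R, hR, ?_, ?_⟩
    · refine ⟨hs.le0, ?_, ?_, ?_⟩
      · rintro ⟨i, z⟩ hp
        rcases Multiset.mem_add.1 hp with h | h
        · have := (key _ (hRM _ (mem_cor.1 h))).2.1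
          simp only at this ⊢; linarith
        · simp only [Multiset.mem_singleton, Prod.mk.injEq] at h
          simp only; omega
      · by_cases hm0 : m = 0
        · left
          refine ⟨hm0, ?_⟩
          rcases hs.mem with h | h
          · exact h.2
          · have := pos_cor c.pos _ h
            simp only at this; omega
        · right
          rw [Multiset.mem_add, mem_cor, Multiset.mem_add, mem_rowm]
          exact Or.inl (Or.inl ⟨hm0, rfl⟩)
      · rintro ⟨i, z⟩ hp hz
        rcases Multiset.mem_add.1 hp with h | h
        · have := (key _ (hRM _ (mem_cor.1 h))).2.2.2
          simp only at this hz ⊢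
          exact this (by linarith)
        · simp only [Multiset.mem_singleton, Prod.mk.injEq] at h
          simp only at hz ⊢
          by_contra hc
          apply e1
          constructor <;> omega
    · refine ⟨hf.le0, ?_, ?_, ?_⟩
      · rintro ⟨i, z⟩ hp
        rcases Multiset.mem_add.1 hp with h | h
        · exact (key _ (hRM' _ h)).1
        · simp only [Multiset.mem_singleton, Prod.mk.injEq] at h
          simp only; omega
      · by_cases hl0 : l = 0
        · left
          refine ⟨hl0, ?_⟩
          rcases hf.mem with h | h
          · exact h.2
          · have := c.pos _ h
            simp only at this; omega
        · right
          rw [Multiset.mem_add, Multiset.mem_add, mem_rowm]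
          exact Or.inl (Or.inl ⟨hl0, rfl⟩)
      · rintro ⟨i, z⟩ hp hz
        rcases Multiset.mem_add.1 hp with h | h
        · exact (key _ (hRM' _ h)).2.2.1 hz
        · simp only [Multiset.mem_singleton, Prod.mk.injEq] at h
          simp only at hz ⊢
          by_contra hc
          apply e2
          constructor <;> omega
  · right; right
    obtain ⟨R, hR⟩ := exists_rest hf.mem
    have hRM : ∀ p ∈ R, p ∈ M := fun p hp => by rw [hR]; exact Multiset.mem_add.2 (Or.inr hp)
    have hm0 : m ≠ 0 := by
      rintro rfl
      exact hd ⟨R, by rw [rowm_zero, add_zero]; exact hR⟩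
    have hmR : (m, P m - y) ∉ R := by
      intro h
      obtain ⟨R', hR'⟩ := Multiset.exists_cons_of_mem h
      apply hd
      refine ⟨R', ?_⟩
      rw [rowm_pos hm0, add_assoc, Multiset.singleton_add, ← hR']
      exact hR
    have hmM : (m, P m - y) ∈ M := by
      rcases hs.mem with h | h
      · exact absurd h.1 hm0
      · exact mem_cor.1 h
    have he := hmM
    rw [hR, Multiset.mem_add, mem_rowm] at he
    rcases he with ⟨hl0, he⟩ | he
    swap
    · exact absurd he hmR
    simp only [Prod.mk.injEq] at he
    obtain ⟨hml, hx⟩ := he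
    subst hml
    obtain ⟨l, rfl⟩ : ∃ l, m = l + 1 := ⟨m - 1, by omega⟩
    have hge : ∀ p ∈ M, x + y ≤ P p.1 := fun p hp => by
      obtain ⟨h1, h2, _, _⟩ := key p hp; linarith
    have hPl : P (l + 1) = x + y := by linarith
    have hxy : x + y ≤ 0 := by linarith [hf.le0, hs.le0]
    have hleft := c.left hxy hPl hge
    have hnol : ∀ p ∈ R, p.1 ≠ l + 1 := by
      intro p hp he
      obtain ⟨h1, h2, h3, h4⟩ := key p (hRM p hp)
      rw [he] at h2
      apply hmR
      have : p = (l + 1, P (l + 1) - y) := by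
        apply Prod.ext
        · exact he
        · simp only; omega
      rw [← this]; exact hp
    have hcnt : cnt (l + 1) M = 1 := by
      rw [hR, rowm_succ, cnt_add, cnt_single, cnt_zero hnol, add_zero]
    have hdiff := c.diff l
    rw [hcnt] at hdiff
    have hn := c.n0 (l + 1)
    have hP2 : P (l + 1 + 1) = x + y + 2 ∧ P l = x + y ∧ n (l + 1) = 0 := by
      rw [show l + 1 + 1 = l + 2 from rfl] at *
      have : P (l + 2) ≠ x + y + 1 := fun h => e1 ⟨h, le_rfl⟩
      refine ⟨?_, ?_, ?_⟩ <;> omega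
    obtain ⟨i, hil, hi, hPi, hno, hni⟩ := c.left_const hxy hPl hge hP2.2.1
    have hPi0 := hPi i le_rfl hil
    have hPi1 : P (i + 1) = x + y := by
      by_cases h : i = l
      · rw [h]; exact hPl
      · exact hPi (i + 1) (by omega) (by omega)
    have hmemi : (i = 0 ∧ x = 0 ∧ y = 0) ∨ (i, x) ∈ R := by
      rcases hi with hi | ⟨p, hp, hi⟩
      · left
        rw [hi, c.P0] at hPi0
        have := hf.le0
        have := hs.le0
        refine ⟨hi, ?_, ?_⟩ <;> omega
      · right
        obtain ⟨h1, h2, h3, h4⟩ := key p hp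
        have hpx : p = (i, x) := by
          apply Prod.ext
          · exact hi
          · rw [hi] at h2
            simp only; omega
        rw [hpx, hR, Multiset.mem_add, mem_rowm] at hp
        rcases hp with hp | hp
        · exfalso
          have := hp.2
          simp only [Prod.mk.injEq] at this
          omega
        · exact hp
    obtain ⟨R', hR'⟩ := exists_rest (M := R) (l := i) (x := x)
      (by rcases hmemi with h | h
          · exact Or.inl ⟨h.1, h.2.1⟩
          · exact Or.inr h)
    have hgap : ∀ p ∈ R, i < p.1 → l + 1 < p.1 := by
      intro p hp hlt
      have h1 := hno p (hRM p hp) hlt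
      have h2 := hnol p hp
      omega
    refine ⟨rfl, hPl, hP2.1, i, by omega, hPi0, hPi1, ?_, R', ?_, ?_, ?_, ?_⟩
    · intro k hk hkl
      by_cases h : k = l + 1
      · rw [h]; exact hP2.2.2
      · exact hni k hk (by omega)
    · rw [add_assoc, ← hR']; exact hR
    · intro p hp
      apply hgap
      rw [hR']; exact Multiset.mem_add.2 (Or.inr hp)
    · rw [← hR']
      refine ⟨hs.le0, ?_, ?_, ?_⟩
      · rintro ⟨j, z⟩ hp
        rcases Multiset.mem_add.1 hp with h | h
        · have := (key _ (hRM _ (mem_cor.1 h))).2.1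
          simp only at this ⊢; linarith
        · simp only [Multiset.mem_singleton, Prod.mk.injEq] at h
          simp only; omega
      · rcases hmemi with h | h
        · exact Or.inl ⟨h.1, h.2.2⟩
        · right
          rw [Multiset.mem_add, mem_cor]
          left
          rw [hPi0, add_sub_cancel_right]; exact h
      · rintro ⟨j, z⟩ hp hz
        rcases Multiset.mem_add.1 hp with h | h
        · have h' := mem_cor.1 h
          have h1 := (key _ (hRM _ h')).2.2.2
          have h2 := hgap _ h'
          simp only at h1 h2 hz ⊢
          have := h1 (by linarith)
          omega
        · simp only [Multiset.mem_singleton, Prod.mk.injEq] at h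
          simp only at hz ⊢
          omega
    · rw [← hR']
      refine ⟨hf.le0, ?_, ?_, ?_⟩
      · rintro ⟨j, z⟩ hp
        rcases Multiset.mem_add.1 hp with h | h
        · exact (key _ (hRM _ h)).1
        · simp only [Multiset.mem_singleton, Prod.mk.injEq] at h
          simp only; omega
      · rcases hmemi with h | h
        · exact Or.inl ⟨h.1, h.2.1⟩
        · right
          rw [Multiset.mem_add]
          exact Or.inl h
      · rintro ⟨j, z⟩ hp hz
        rcases Multiset.mem_add.1 hp with h | h
        · have h1 := (key _ (hRM _ h)).2.2.1 hz
          have h2 := hgap _ h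
          simp only at h1 h2 hz ⊢
          omega
        · simp only [Multiset.mem_singleton, Prod.mk.injEq] at h
          simp only at hz ⊢
          omega


/-- Finite support and positive row lengths. -/
structure Wf (ν : RCraw I) : Prop where
  fin : FinS ν
  pos : ∀ a, Pos (ν a)

theorem FinS.of_ne {ν ν' : RCraw I} (h : FinS ν) (a : I) (h' : ∀ b, b ≠ a → ν b = 0 → ν' b = 0) :
    FinS ν' := by
  apply Set.Finite.subset (h.insert a)
  intro b hb
  by_cases hba : b = a
  · exact Or.inl hba
  · right
    exact fun h0 => hb (h' b hba h0)

theorem pInf_update (A : I → I → ℤ) {ν ν' : RCraw I} (h : FinS ν) (h' : FinS ν') (a : I)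
    (hm : ∀ b, rcSize ν' b = rcSize ν b + if b = a then 1 else 0)
    (b : I) : pInf A ν' b = pInf A ν b - A b a := by
  obtain ⟨S, ha, hS⟩ := h.exists a
  obtain ⟨S', _, hS'⟩ := h'.exists a
  rw [pInf_eq_sum A (S := S ∪ S') (fun b hb => Finset.mem_union_left _ (hS b hb)),
    pInf_eq_sum A (S := S ∪ S') (fun b hb => Finset.mem_union_right _ (hS' b hb))]
  have : ∀ c ∈ S ∪ S', A b c * rcSize ν' c = A b c * rcSize ν c +
      if c = a then A b a else 0 := by
    intro c _
    rw [hm, mul_add]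
    split_ifs with h1
    · subst h1; ring
    · ring
  rw [Finset.sum_congr rfl this, Finset.sum_add_distrib, Finset.sum_ite_eq' ,
    if_pos (Finset.mem_union_left _ ha)]
  ring

/-- Total length of the rows. -/
def tlen (M : Multiset (ℕ × ℤ)) : ℤ := (M.map fun p => (p.1 : ℤ)).sum
theorem tlen_add (M N) : tlen (M + N) = tlen M + tlen N := by simp [tlen]
theorem tlen_shf (l k M) : tlen (shf l k M) = tlen M := by
  simp [tlen, shf, Multiset.map_map]
theorem tlen_single (l x) : tlen {(l, x)} = l := by simp [tlen]
theorem tlen_rowm (l x) : tlen (rowm l x) = l := by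
  unfold rowm; split_ifs with h <;> simp [tlen, h]

theorem hdiv {k h : ℤ} (hh : k = 2 * h) : k / 2 = h := by omega

/-- Full description of `fOp`. -/
theorem f_desc (A : I → I → ℤ) (a : I) {h : ℤ} (hh : A a a = 2 * h) {ν : RCraw I} (w : Wf ν)
    {l : ℕ} {x : ℤ} {R : Multiset (ℕ × ℤ)} (hs : SelF (ν a) l x) (hR : ν a = rowm l x + R) :
    Wf (fOp A a ν) ∧ (fOp A a ν a = shf l (2 * h) R + {(l + 1, x - h)}) ∧
    (∀ b, b ≠ a → fOp A a ν b = shf l (A b a) (ν b)) ∧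
    (∀ b i, vac A (fOp A a ν) b i = vac A ν b i - if l < i then A b a else 0) ∧
    (∀ b, rcSize (fOp A a ν) b = rcSize ν b + if b = a then 1 else 0) ∧
    (∀ b, pInf A (fOp A a ν) b = pInf A ν b - A b a) ∧
    cor (vac A (fOp A a ν) a) (fOp A a ν a) =
      cor (vac A ν a) R + {(l + 1, vac A ν a (l + 1) - x - h)} ∧
    (∀ b, b ≠ a → cor (vac A (fOp A a ν) b) (fOp A a ν b) = cor (vac A ν b) (ν b)) := by
  have e := fOp_eq A a ν (w.pos a) hs hR
  have ea : fOp A a ν a = shf l (2 * h) R + {(l + 1, x - h)} := by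
    rw [e]; simp only [if_true]; rw [hh, hdiv rfl]
  have eb : ∀ b, b ≠ a → fOp A a ν b = shf l (A b a) (ν b) := by
    intro b hb; rw [e]; simp [hb]
  have hfin : FinS (fOp A a ν) := w.fin.of_ne a (fun b hb h0 => by rw [eb b hb, h0]; rfl)
  have hw : Wf (fOp A a ν) := by
    refine ⟨hfin, fun b => ?_⟩
    by_cases hb : b = a
    · rw [hb, ea]; exact pos_add (pos_shf ((w.pos a).right hR)) (pos_single _ _)
    · rw [eb b hb]; exact pos_shf (w.pos b)
  have hv := vac_update A w.fin hfin a l (fun i b => by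
    by_cases hb : b = a
    · subst hb
      rw [ea, hR, msum_add, msum_add, msum_shf, msum_single, msum_rowm, if_pos rfl]
      split_ifs <;> push_cast <;> omega
    · rw [eb b hb, msum_shf, if_neg hb, add_zero])
  have hsz : ∀ b, rcSize (fOp A a ν) b = rcSize ν b + if b = a then 1 else 0 := by
    intro b
    change tlen _ = tlen _ + _
    by_cases hb : b = a
    · subst hb
      rw [ea, hR, tlen_add, tlen_add, tlen_shf, tlen_single, tlen_rowm, if_pos rfl]
      push_cast; ring
    · rw [eb b hb, tlen_shf, if_neg hb, add_zero]
  refine ⟨hw, ea, eb, hv, hsz, pInf_update A w.fin hfin a hsz, ?_, ?_⟩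
  · rw [ea, cor_add, cor_single, cor_shf (vac A ν a) _ l (2 * h) (fun i => by rw [hv, hh])]
    rw [hv, if_pos (by omega), hh]
    congr 3; ring
  · intro b hb
    rw [eb b hb, cor_shf (vac A ν b) _ l (A b a) (fun i => by rw [hv])]

/-- Full description of `fStar`. -/
theorem s_desc (A : I → I → ℤ) (a : I) {h : ℤ} (hh : A a a = 2 * h) {ν : RCraw I} (w : Wf ν)
    {m : ℕ} {y : ℤ} {R : Multiset (ℕ × ℤ)} (hs : SelF (cor (vac A ν a) (ν a)) m y)
    (hR : ν a = rowm m (vac A ν a m - y) + R) :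
    Wf (fStar A a ν) ∧ (fStar A a ν a = R + {(m + 1, vac A ν a (m + 1) - y - h)}) ∧
    (∀ b, b ≠ a → fStar A a ν b = ν b) ∧
    (∀ b i, vac A (fStar A a ν) b i = vac A ν b i - if m < i then A b a else 0) ∧
    (∀ b, pInf A (fStar A a ν) b = pInf A ν b - A b a) ∧
    cor (vac A (fStar A a ν) a) (fStar A a ν a) =
      shf m (2 * h) (cor (vac A ν a) R) + {(m + 1, y - h)} := by
  have e := fStar_eq A a ν (w.pos a) hs hR
  have ea : fStar A a ν a = R + {(m + 1, vac A ν a (m + 1) - y - h)} := by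
    rw [e]; simp only [if_true]; rw [hh, hdiv rfl]; congr 3; ring
  have eb : ∀ b, b ≠ a → fStar A a ν b = ν b := by
    intro b hb; rw [e]; simp [hb]
  have hfin : FinS (fStar A a ν) := w.fin.of_ne a (fun b hb h0 => by rw [eb b hb, h0])
  have hw : Wf (fStar A a ν) := by
    refine ⟨hfin, fun b => ?_⟩
    by_cases hb : b = a
    · rw [hb, ea]; exact pos_add ((w.pos a).right hR) (pos_single _ _)
    · rw [eb b hb]; exact w.pos b
  have hv := vac_update A w.fin hfin a m (fun i b => by
    by_cases hb : b = a
    · subst hb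
      rw [ea, if_pos rfl]
      conv_rhs => rw [hR]
      rw [msum_add, msum_add, msum_single, msum_rowm]
      split_ifs <;> push_cast <;> omega
    · rw [eb b hb, if_neg hb, add_zero])
  have hsz : ∀ b, rcSize (fStar A a ν) b = rcSize ν b + if b = a then 1 else 0 := by
    intro b
    change tlen _ = tlen _ + _
    by_cases hb : b = a
    · subst hb
      rw [ea, if_pos rfl]
      conv_rhs => rw [hR]
      rw [tlen_add, tlen_add, tlen_single, tlen_rowm]
      push_cast; ring
    · rw [eb b hb, if_neg hb, add_zero]
  refine ⟨hw, ea, eb, hv, pInf_update A w.fin hfin a hsz, ?_⟩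
  rw [ea, cor_add, cor_single, hv, if_pos (by omega), hh]
  congr 1
  · simp only [cor, shf, Multiset.map_map]
    apply Multiset.map_congr rfl
    intro p _
    simp only [Function.comp, hv, hh]
    rw [sub_right_comm]
  · congr 2; ring

theorem exists_rest_cor {P : ℕ → ℤ} (P0 : P 0 = 0) {M : Multiset (ℕ × ℤ)} {m : ℕ} {y : ℤ}
    (hs : SelF (cor P M) m y) : ∃ R, M = rowm m (P m - y) + R := by
  apply exists_rest
  rcases hs.mem with ⟨rfl, rfl⟩ | h
  · left; simp [P0]
  · right; exact mem_cor.1 h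

theorem selF_ex (M : Multiset (ℕ × ℤ)) : ∃ l x, SelF M l x := ⟨_, _, selF_exists M⟩

theorem vac_zero (A : I → I → ℤ) (ν : RCraw I) (a : I) : vac A ν a 0 = 0 := by
  have : ∀ b : I, A a b * ((ν b).map fun p => (min ((0 : ℕ) : ℤ) (p.1 : ℤ))).sum = 0 := by
    intro b
    have : (ν b).map (fun p => (min ((0 : ℕ) : ℤ) (p.1 : ℤ))) = (ν b).map (fun _ => 0) := by
      apply Multiset.map_congr rfl
      intro p _
      simp
    rw [this]; simp
  unfold vac
  rw [finsum_congr this]; simp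

theorem K0core (A : I → I → ℤ) (a : I) {ν : RCraw I} (w : Wf ν)
    {l : ℕ} {x y : ℤ} (hs : SelF (ν a) l x) (ht : SelF (cor (vac A ν a) (ν a)) l y)
    {h : ℤ} (hh : A a a = 2 * h)
    (h0 : vac A ν a l = x + y) (h1 : vac A ν a (l + 1) = x + y)
    (hb : ∀ b, b ≠ a → ∀ p ∈ ν b, l < p.1 → A b a = 0)
    (ha : ∀ p ∈ ν a, A a a = 0 ∨ p.1 ≤ l) : fOp A a ν = fStar A a ν := by
  obtain ⟨R, hR⟩ := exists_rest hs.mem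
  have hR' : ν a = rowm l (vac A ν a l - y) + R := by rw [h0, add_sub_cancel_right]; exact hR
  obtain ⟨-, f1, f2, -⟩ := f_desc A a hh w hs hR
  obtain ⟨-, s1, s2, -⟩ := s_desc A a hh w ht hR'
  funext b
  by_cases hba : b = a
  · subst hba
    rw [f1, s1, h1, add_sub_cancel_right, shf_id]
    intro p hp
    rw [← hh]
    exact ha p (by rw [hR]; exact Multiset.mem_add.2 (Or.inr hp))
  · rw [f2 b hba, s2 b hba, shf_id]
    intro p hp
    by_cases hl : l < p.1
    · exact Or.inl (hb b hba p hp hl)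
    · right; omega

theorem comm_core (A : I → I → ℤ) (a : I) {ν : RCraw I} (w : Wf ν)
    {l m : ℕ} {x y : ℤ} (hs : SelF (ν a) l x) (ht : SelF (cor (vac A ν a) (ν a)) m y)
    {h : ℤ} (hh : A a a = 2 * h) {R : Multiset (ℕ × ℤ)}
    (hR : ν a = rowm l x + rowm m (vac A ν a m - y) + R)
    (h1 : SelF (cor (vac A ν a) (rowm m (vac A ν a m - y) + R) +
      {(l + 1, vac A ν a (l + 1) - x - h)}) m y)
    (h2 : SelF (rowm l x + R + {(m + 1, vac A ν a (m + 1) - y - h)}) l x) :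
    fOp A a (fStar A a ν) = fStar A a (fOp A a ν) := by
  obtain ⟨fw, f1, f2, f3, -, -, f4, -⟩ := f_desc A a hh w hs (R := rowm m (vac A ν a m - y) + R)
    (by rw [← add_assoc]; exact hR)
  obtain ⟨sw, s1, s2, -⟩ := s_desc A a hh w ht (R := rowm l x + R)
    (by rw [← add_assoc, add_comm (rowm m _)]; exact hR)
  rw [← f4] at h1
  rw [← s1] at h2
  obtain ⟨-, g1, g2, -⟩ := f_desc A a hh sw h2 (R := R + {(m + 1, vac A ν a (m + 1) - y - h)})
    (by rw [s1, add_assoc])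
  obtain ⟨-, t1, t2, -⟩ := s_desc A a hh fw h1 (R := shf l (2 * h) R + {(l + 1, x - h)})
    (by rw [f1, shf_add, shf_rowm, f3, hh, add_assoc, sub_right_comm])
  funext b
  by_cases hba : b = a
  · subst hba
    rw [g1, t1, shf_add, shf_single, f3, hh, add_right_comm]
    congr 3; ring
  · rw [g2 b hba, t2 b hba, s2 b hba, f2 b hba]

theorem S1_comm (A : I → I → ℤ) (a : I) {ν : RCraw I} (w : Wf ν)
    {l : ℕ} {x y : ℤ} (hs : SelF (ν a) l x) (ht : SelF (cor (vac A ν a) (ν a)) l y)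
    (hh : A a a = 2 * 1) {R : Multiset (ℕ × ℤ)}
    (hR : ν a = rowm l x + R)
    (p0 : vac A ν a l = x + y) (p1 : vac A ν a (l + 1) = x + y + 1)
    (p2 : vac A ν a (l + 2) = x + y + 2)
    (hb : ∀ b, b ≠ a → ∀ p ∈ ν b, p.1 = l + 1 → A b a = 0)
    (ha : ∀ p ∈ R, p.1 ≠ l + 1)
    (h1 : SelF (cor (vac A ν a) R + {(l + 1, vac A ν a (l + 1) - x - 1)}) (l + 1) y)
    (h2 : SelF (R + {(l + 1, vac A ν a (l + 1) - y - 1)}) (l + 1) x) :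
    fOp A a (fStar A a ν) = fStar A a (fOp A a ν) := by
  obtain ⟨fw, f1, f2, f3, -, -, f4, -⟩ := f_desc A a hh w hs hR
  obtain ⟨sw, s1, s2, -⟩ := s_desc A a hh w ht (R := R)
    (by rw [p0, add_sub_cancel_right]; exact hR)
  rw [← f4] at h1
  rw [← s1] at h2
  obtain ⟨-, g1, g2, -⟩ := f_desc A a hh sw h2 (R := R)
    (by rw [s1, rowm_succ, add_comm, p1]; congr 3; ring)
  obtain ⟨-, t1, t2, -⟩ := s_desc A a hh fw h1 (R := shf l (2 * 1) R)
    (by rw [f1, rowm_succ, add_comm, f3, if_pos (by omega), hh, p1]; congr 3; ring)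
  funext b
  by_cases hba : b = a
  · subst hba
    rw [g1, t1, f3, if_pos (by omega), hh, show l + 1 + 1 = l + 2 from rfl, p2]
    congr 1
    · apply shf_congr
      intro p hp
      right
      have := ha p hp
      omega
    · congr 2; ring
  · rw [g2 b hba, t2 b hba, s2 b hba, f2 b hba]
    apply shf_congr
    intro p hp
    by_cases hl : p.1 = l + 1
    · exact Or.inl (hb b hba p hp hl)
    · right; omega

theorem S2_comm (A : I → I → ℤ) (a : I) {ν : RCraw I} (w : Wf ν)
    {l i : ℕ} {x y : ℤ} (hs : SelF (ν a) l x) (ht : SelF (cor (vac A ν a) (ν a)) l y)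
    (hh : A a a = 2 * 1) {R : Multiset (ℕ × ℤ)} (hil : i < l)
    (hR : ν a = rowm l x + rowm i x + R)
    (p0 : vac A ν a l = x + y) (p1 : vac A ν a (l + 1) = x + y + 2)
    (p2 : vac A ν a i = x + y) (p3 : vac A ν a (i + 1) = x + y)
    (hb : ∀ b, b ≠ a → ∀ p ∈ ν b, i < p.1 → p.1 ≤ l → A b a = 0)
    (ha : ∀ p ∈ R, i < p.1 → l < p.1)
    (h1 : SelF (cor (vac A ν a) (rowm i x + R) + {(l + 1, vac A ν a (l + 1) - x - 1)}) i y)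
    (h2 : SelF (rowm i x + R + {(l + 1, vac A ν a (l + 1) - y - 1)}) i x) :
    fOp A a (fStar A a ν) = fStar A a (fOp A a ν) := by
  obtain ⟨fw, f1, f2, f3, -, -, f4, -⟩ := f_desc A a hh w hs (R := rowm i x + R)
    (by rw [← add_assoc]; exact hR)
  obtain ⟨sw, s1, s2, -⟩ := s_desc A a hh w ht (R := rowm i x + R)
    (by rw [p0, add_sub_cancel_right, ← add_assoc]; exact hR)
  rw [← f4] at h1
  rw [← s1] at h2
  obtain ⟨-, g1, g2, -⟩ := f_desc A a hh sw h2 (R := R + {(l + 1, vac A ν a (l + 1) - y - 1)})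
    (by rw [s1, add_assoc])
  obtain ⟨-, t1, t2, -⟩ := s_desc A a hh fw h1 (R := shf l (2 * 1) R + {(l + 1, x - 1)})
    (by rw [f1, shf_add, shf_rowm, f3, hh, add_assoc, p2, if_neg (by omega), sub_zero, sub_zero,
          add_sub_cancel_right])
  funext b
  by_cases hba : b = a
  · subst hba
    rw [g1, t1, f3, if_neg (by omega), p3, shf_add, shf_single, if_pos (by omega), p1]
    congr 1
    · congr 1
      · apply shf_congr
        intro p hp
        right
        have := ha p hp
        omega
      · congr 2; ring
    · congr 2; ring
  · rw [g2 b hba, t2 b hba, s2 b hba, f2 b hba]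
    apply shf_congr
    intro p hp
    by_cases hl : i < p.1 ∧ p.1 ≤ l
    · exact Or.inl (hb b hba p hp hl.1 hl.2)
    · right; omega

/-- Operators of different colors commute. -/
theorem L0 (A : I → I → ℤ) (hA : IsBorcherdsCartan A) {a b : I} (hab : a ≠ b) {ν : RCraw I}
    (w : Wf ν) : fOp A a (fStar A b ν) = fStar A b (fOp A a ν) := by
  have hev : ∀ c, ∃ h, A c c = 2 * h := fun c => by
    rcases hA.diag c with h | ⟨_, h⟩
    · exact ⟨1, by omega⟩
    · obtain ⟨k, hk⟩ := h; exact ⟨k, by omega⟩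
  obtain ⟨h, hh⟩ := hev a
  obtain ⟨k, hk⟩ := hev b
  obtain ⟨l, x, hs⟩ := selF_ex (ν a)
  obtain ⟨R, hR⟩ := exists_rest hs.mem
  obtain ⟨m, y, ht⟩ := selF_ex (cor (vac A ν b) (ν b))
  obtain ⟨T, hT⟩ := exists_rest_cor (vac_zero A ν b) ht
  obtain ⟨fw, f1, f2, f3, -, -, -, f4⟩ := f_desc A a hh w hs hR
  obtain ⟨sw, s1, s2, -⟩ := s_desc A b hk w ht hT
  have hs' : SelF (fStar A b ν a) l x := by rw [s2 a hab]; exact hs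
  have ht' : SelF (cor (vac A (fOp A a ν) b) (fOp A a ν b)) m y := by
    rw [f4 b hab.symm]; exact ht
  obtain ⟨-, g1, g2, -⟩ := f_desc A a hh sw hs' (R := R) (by rw [s2 a hab]; exact hR)
  obtain ⟨-, t1, t2, -⟩ := s_desc A b hk fw ht' (R := shf l (A b a) T) (by
    rw [f2 b hab.symm]
    conv_lhs => rw [hT]
    rw [shf_add, shf_rowm, f3, sub_right_comm])
  funext c
  by_cases hca : c = a
  · subst hca
    rw [g1, t2 _ hab, f1]
  · by_cases hcb : c = b
    · subst hcb
      rw [g2 _ hca, t1, s1, shf_add, shf_single, f3]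
      congr 3; ring
    · rw [g2 _ hca, t2 _ hcb, f2 _ hca, s2 _ hcb]


theorem real_K0 {A : I → I → ℤ} (hA : IsBorcherdsCartan A) (a : I) (h2 : A a a = 2) {ν : RCraw I}
    (w : Wf ν) {l m : ℕ} {x y : ℤ} (hs : SelF (ν a) l x)
    (ht : SelF (cor (vac A ν a) (ν a)) m y) (hq : pInf A ν a ≤ x + y) :
    fOp A a ν = fStar A a ν := by
  obtain ⟨n, c, hn⟩ := exists_cfg hA w.fin a (w.pos a) (h := 1) (by omega)
  obtain ⟨key, hl, hm⟩ := sel_facts c.P0 hs ht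
  obtain ⟨t1, t2, t3⟩ := c.tail hl (fun p hp hlt => by
    obtain ⟨h1, h2, h3, h4⟩ := key p hp
    by_contra hc
    have := h3 (by omega)
    omega) hq
  obtain ⟨u1, u2, u3⟩ := c.tail hm (fun p hp hlt => by
    obtain ⟨h1, h2, h3, h4⟩ := key p hp
    by_contra hc
    have := h4 (by omega)
    omega) hq
  have hml : m = l := by
    apply le_antisymm
    · rcases ht.mem with h | h
      · omega
      · exact t3 _ (mem_cor.1 h)
    · rcases hs.mem with h | h
      · omega
      · exact u3 _ h
  subst hml
  refine K0core A a w hs ht (h := 1) (by omega) (t1 _ le_rfl) (t1 _ (by omega)) ?_ ?_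
  · intro b hb p hp hlt
    exact hn p.1 (t2 _ hlt) b hb p hp rfl
  · intro p hp
    exact Or.inr (t3 p hp)

theorem min_shf {M R : Multiset (ℕ × ℤ)} {l : ℕ} {x : ℤ} (hs : SelF M l x)
    (hR : M = rowm l x + R) : ∃ l', SelF (shf l (2 * 1) R + {(l + 1, x - 1)}) l' (x - 1) := by
  have hRM : ∀ p ∈ R, p ∈ M := fun p hp => by rw [hR]; exact Multiset.mem_add.2 (Or.inr hp)
  apply selF_of_min
  · linarith [hs.le0]
  · intro p hp
    rcases Multiset.mem_add.1 hp with h | h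
    · obtain ⟨q, hq, rfl⟩ := Multiset.mem_map.1 h
      have h1 := hs.le q (hRM q hq)
      have h2 := hs.max q (hRM q hq)
      simp only
      split_ifs with h3
      · have : q.2 ≠ x := fun h => by have := h2 h; omega
        omega
      · omega
    · rw [Multiset.mem_singleton.1 h]
  · right
    exact ⟨_, Multiset.mem_add.2 (Or.inr (Multiset.mem_singleton_self _)), rfl⟩

theorem real_comm {A : I → I → ℤ} (hA : IsBorcherdsCartan A) (a : I) (h2 : A a a = 2)
    {ν : RCraw I} (w : Wf ν) {l m : ℕ} {x y : ℤ} (hs : SelF (ν a) l x)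
    (ht : SelF (cor (vac A ν a) (ν a)) m y) (hq : x + y + 2 ≤ pInf A ν a) :
    fOp A a (fStar A a ν) = fStar A a (fOp A a ν) := by
  obtain ⟨n, c, hn⟩ := exists_cfg hA w.fin a (w.pos a) (h := 1) (by omega)
  rcases trichotomy c hs ht hq with ⟨R, hR, h3, h4⟩ |
    ⟨hml, p0, p1, p2, hn1, R, hR, hno, h3, h4⟩ |
    ⟨hml, p0, p1, i, hil, p2, p3, hni, R, hR, hno, h3, h4⟩
  · exact comm_core A a w hs ht (by omega) hR h3 h4
  · subst hml
    exact S1_comm A a w hs ht (by omega) hR p0 p1 p2 (fun b hb p hp he => hn _ hn1 b hb p hp he)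
      hno h3 h4
  · subst hml
    exact S2_comm A a w hs ht (by omega) hil hR p0 p1 p2 p3
      (fun b hb p hp e1 e2 => hn _ (hni _ e1 e2) b hb p hp rfl) hno h3 h4

theorem real_D {A : I → I → ℤ} (hA : IsBorcherdsCartan A) (a : I) (h2 : A a a = 2)
    {ν : RCraw I} (w : Wf ν) : fOp A a (fStar A a ν) = fStar A a (fOp A a ν) ∨
      (fOp A a (fStar A a ν) = fStar A a (fStar A a ν) ∧
        fStar A a (fOp A a ν) = fOp A a (fOp A a ν)) := by
  obtain ⟨l, x, hs⟩ := selF_ex (ν a)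
  obtain ⟨R, hR⟩ := exists_rest hs.mem
  obtain ⟨m, y, ht⟩ := selF_ex (cor (vac A ν a) (ν a))
  obtain ⟨T, hT⟩ := exists_rest_cor (vac_zero A ν a) ht
  by_cases hq : x + y + 2 ≤ pInf A ν a
  · exact Or.inl (real_comm hA a h2 w hs ht hq)
  right
  obtain ⟨n, c, hn⟩ := exists_cfg hA w.fin a (w.pos a) (h := 1) (by omega)
  have hh : A a a = 2 * 1 := by omega
  obtain ⟨fw, f1, f2, f3, -, f5, f4, -⟩ := f_desc A a hh w hs hR
  obtain ⟨sw, s1, s2, s3, s5, s4⟩ := s_desc A a hh w ht hT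
  have hT' : cor (vac A ν a) (ν a) = rowm m y + cor (vac A ν a) T := by
    conv_lhs => rw [hT]
    rw [cor_add, cor_rowm, sub_sub_cancel]
  obtain ⟨l', hs'⟩ := min_shf hs hR
  obtain ⟨m', ht'⟩ := min_shf ht hT'
  rw [← f1] at hs'
  rw [← s4] at ht'
  by_cases hq1 : x + y + 1 ≤ pInf A ν a
  · obtain ⟨m1, hm1⟩ := attained c hs ht hq1 hR
    obtain ⟨l1, hl1⟩ := attained c.dual ht (by rw [cor_cor]; exact hs) (by omega) hT'
    rw [cor_cor, ← s1] at hl1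
    rw [← f4] at hm1
    refine ⟨real_K0 hA a h2 sw hl1 ht' ?_, (real_K0 hA a h2 fw hs' hm1 ?_).symm⟩
    · rw [s5]; omega
    · rw [f5]; omega
  · have e := real_K0 hA a h2 w hs ht (by omega)
    have : fOp A a (fOp A a ν) = fStar A a (fOp A a ν) := by
      rw [← e] at ht'
      refine real_K0 hA a h2 fw hs' ht' ?_
      rw [f5]; omega
    rw [← e]
    exact ⟨this, this.symm⟩

theorem real_eOp_none {A : I → I → ℤ} {a : I} (h2 : A a a = 2) {ν : RCraw I} (hp : Pos (ν a))
    (he : eOp A a ν = none) : ∀ p ∈ ν a, 0 ≤ p.2 := by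
  by_contra hc
  push Not at hc
  obtain ⟨p, hp1, hp2⟩ := hc
  obtain ⟨l, x, hs⟩ := selF_ex (ν a)
  have hx := hs.le p hp1
  obtain ⟨l', hE⟩ := exists_selE_of_min A a (ν a) x hs.le (by
    rcases hs.mem with h | h
    · omega
    · exact ⟨_, h, rfl⟩) (by rw [if_pos h2]; omega)
  obtain ⟨R, hR⟩ := Multiset.exists_cons_of_mem hE.mem
  rw [eOp_eq A a ν hp hE (R := R) (by rw [hR, Multiset.singleton_add])] at he
  exact absurd he (by simp)

theorem real_L2 {A : I → I → ℤ} (hA : IsBorcherdsCartan A) (a : I) (h2 : A a a = 2)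
    {ν ν' : RCraw I} (w : Wf ν) (hn : eOp A a ν = none) (he : eOp A a (fStar A a ν) = some ν') :
    fOp A a ν = fStar A a ν := by
  obtain ⟨l, x, hs⟩ := selF_ex (ν a)
  obtain ⟨m, y, ht⟩ := selF_ex (cor (vac A ν a) (ν a))
  obtain ⟨T, hT⟩ := exists_rest_cor (vac_zero A ν a) ht
  obtain ⟨n, c, -⟩ := exists_cfg hA w.fin a (w.pos a) (h := 1) (by omega)
  have hh : A a a = 2 * 1 := by omega
  obtain ⟨sw, s1, s2, s3, s5, s4⟩ := s_desc A a hh w ht hT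
  obtain ⟨key, hl, hm⟩ := sel_facts c.P0 hs ht
  have h0 := real_eOp_none h2 (w.pos a) hn
  obtain ⟨l', x', hE⟩ := exists_selE A a _ he
  have hc := hE.cond
  rw [if_pos h2] at hc
  have hx : x = 0 := by
    have := hs.le0
    rcases hs.mem with h | h
    · exact h.2
    · have := h0 _ h
      simp only at this; omega
  have hmem := hE.mem
  rw [s1, Multiset.mem_add, Multiset.mem_singleton, Prod.mk.injEq] at hmem
  rcases hmem with h | h
  · have := h0 (l', x') (by rw [hT]; exact Multiset.mem_add.2 (Or.inr h))
    simp only at this; omega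
  refine real_K0 hA a h2 w hs ht ?_
  by_contra hq
  have := c.right hm (fun p hp hlt => by
    obtain ⟨h1, h2, h3, h4⟩ := key p hp
    by_contra hc
    have := h4 (by omega)
    omega) (by omega)
  omega


theorem imag_mono {M : Multiset (ℕ × ℤ)} {P n : ℕ → ℤ} {q h : ℤ} (c : Cfg h M P n q) (hh : h ≤ 0)
    (i : ℕ) : P i ≤ P (i + 1) := by
  obtain ⟨L, hL⟩ := c.ev
  have key : ∀ j i, L ≤ i + j → P i ≤ P (i + 1) := by
    intro j
    induction j with
    | zero => intro i hi; rw [hL i (by omega), hL (i + 1) (by omega)]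
    | succ j ih =>
      intro i hi
      have h1 := ih (i + 1) (by omega)
      rw [show i + 1 + 1 = i + 2 from rfl] at h1
      have h2 := c.diff i
      have h3 := c.n0 (i + 1)
      have h4 : h * cnt (i + 1) M ≤ 0 := mul_nonpos_of_nonpos_of_nonneg hh (cnt_nonneg _ _)
      linarith
  exact key L i (by omega)

theorem imag_monotone {M : Multiset (ℕ × ℤ)} {P n : ℕ → ℤ} {q h : ℤ} (c : Cfg h M P n q)
    (hh : h ≤ 0) : Monotone P := monotone_nat_of_le_succ (imag_mono c hh)

theorem imag_nonneg {M : Multiset (ℕ × ℤ)} {P n : ℕ → ℤ} {q h : ℤ} (c : Cfg h M P n q)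
    (hh : h ≤ 0) (i : ℕ) : 0 ≤ P i := by
  rw [← c.P0]; exact imag_monotone c hh (Nat.zero_le i)

theorem imag_d {M : Multiset (ℕ × ℤ)} {P n : ℕ → ℤ} {q h : ℤ} (c : Cfg h M P n q)
    (hh : h ≤ 0) (i : ℕ) : P (i + 1) - P i ≤ P 1 := by
  induction i with
  | zero => simp [c.P0]
  | succ i ih =>
    have h2 := c.diff i
    have h3 := c.n0 (i + 1)
    have h4 : h * cnt (i + 1) M ≤ 0 := mul_nonpos_of_nonpos_of_nonneg hh (cnt_nonneg _ _)
    rw [show i + 1 + 1 = i + 2 from rfl]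
    linarith

theorem imag_P1 {M : Multiset (ℕ × ℤ)} {P n : ℕ → ℤ} {q h : ℤ} (c : Cfg h M P n q)
    (hh : h ≤ 0) {p : ℕ × ℤ} (hp : p ∈ M) : -2 * h ≤ P 1 := by
  obtain ⟨i, hi⟩ : ∃ i, p.1 = i + 1 := ⟨p.1 - 1, by have := c.pos p hp; omega⟩
  have h2 := c.diff i
  have h3 := c.n0 (i + 1)
  have h4 : 1 ≤ cnt (i + 1) M := cnt_pos hp hi
  have h5 := imag_d c hh i
  have h6 := imag_mono c hh (i + 1)
  rw [show i + 1 + 1 = i + 2 from rfl] at h6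
  nlinarith

theorem imag_zero {M : Multiset (ℕ × ℤ)} {P n : ℕ → ℤ} {q h : ℤ} (c : Cfg h M P n q)
    (hh : h ≤ 0) {m : ℕ} (hm : P (m + 1) = 0) : (∀ i, P i = 0) ∧ ∀ j, 1 ≤ j → n j = 0 := by
  have h1 : P 1 = 0 := by
    have := imag_monotone c hh (show 1 ≤ m + 1 by omega)
    have := imag_nonneg c hh 1
    omega
  have hP : ∀ i, P i = 0 := by
    intro i
    induction i with
    | zero => exact c.P0
    | succ i ih =>
      have := imag_d c hh i
      have := imag_nonneg c hh (i + 1)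
      omega
  refine ⟨hP, fun j hj => ?_⟩
  obtain ⟨i, rfl⟩ : ∃ i, j = i + 1 := ⟨j - 1, by omega⟩
  have h2 := c.diff i
  rw [hP, hP, hP] at h2
  have h3 := c.n0 (i + 1)
  have h4 : h * cnt (i + 1) M ≤ 0 := mul_nonpos_of_nonpos_of_nonneg hh (cnt_nonneg _ _)
  linarith

/-- Invariant for an imaginary color. -/
structure GI (h : ℤ) (P : ℕ → ℤ) (M : Multiset (ℕ × ℤ)) : Prop where
  rig : ∀ p ∈ M, -h ≤ p.2
  cor : ∀ p ∈ M, -h ≤ P p.1 - p.2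
  uniq : ∀ r R, M = {r} + R → r.2 = -h → ∀ q ∈ R, -3 * h ≤ q.2 ∧ -h < q.2

theorem GI.mono {h : ℤ} {P P' : ℕ → ℤ} {M : Multiset (ℕ × ℤ)} (g : GI h P M)
    (hP : ∀ i, P i ≤ P' i) : GI h P' M :=
  ⟨g.rig, fun p hp => by have := g.cor p hp; have := hP p.1; omega, g.uniq⟩

theorem mem_split {α : Type*} {M : Multiset α} {r : α} (h : r ∈ M) : ∃ R, M = {r} + R := by
  obtain ⟨R, hR⟩ := Multiset.exists_cons_of_mem h
  exact ⟨R, by rw [hR, Multiset.singleton_add]⟩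

theorem imag_degenerate {M : Multiset (ℕ × ℤ)} {P n : ℕ → ℤ} {q h : ℤ} (c : Cfg h M P n q)
    (hh : h ≤ 0) (g : GI h P M) {m : ℕ} (hm : P (m + 1) = 0) :
    M = 0 ∨ (h = 0 ∧ ∃ j, 1 ≤ j ∧ M = {(j, 0)}) := by
  by_cases h0 : M = 0
  · exact Or.inl h0
  right
  obtain ⟨p, hp⟩ := Multiset.exists_mem_of_ne_zero h0
  obtain ⟨hP, -⟩ := imag_zero c hh hm
  have h1 := imag_P1 c hh hp
  rw [hP] at h1
  have hh0 : h = 0 := by omega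
  subst hh0
  have hz : ∀ p ∈ M, p.2 = 0 := fun p hp => by
    have := g.rig p hp
    have := g.cor p hp
    rw [hP] at this
    omega
  refine ⟨rfl, p.1, c.pos p hp, ?_⟩
  obtain ⟨R, hR⟩ := mem_split hp
  have hR0 : R = 0 := by
    by_contra hc
    obtain ⟨q, hq⟩ := Multiset.exists_mem_of_ne_zero hc
    have h2 := (g.uniq p R hR (by rw [hz p hp]; rfl) q hq).2
    rw [hz q (by rw [hR]; exact Multiset.mem_add.2 (Or.inr hq))] at h2
    omega
  rw [hR, hR0, add_zero]
  congr 1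
  exact Prod.ext rfl (hz p hp)

theorem GI.sel {h : ℤ} {P : ℕ → ℤ} {M : Multiset (ℕ × ℤ)} (g : GI h P M) (hh : h ≤ 0)
    {l : ℕ} {x : ℤ} (hs : SelF M l x) : x = 0 := by
  have := hs.le0
  rcases hs.mem with h | h
  · exact h.2
  · have := g.rig _ h
    simp only at this; omega

theorem GI.sel' {h : ℤ} {P : ℕ → ℤ} {M : Multiset (ℕ × ℤ)} (g : GI h P M) (hh : h ≤ 0)
    {l : ℕ} {x : ℤ} (hs : SelF (_root_.cor P M) l x) : x = 0 := by
  have := hs.le0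
  rcases hs.mem with h | h
  · exact h.2
  · have := g.cor _ (mem_cor.1 h)
    simp only at this; omega

theorem GI.step {M R : Multiset (ℕ × ℤ)} {P P' n : ℕ → ℤ} {q h : ℤ} (c : Cfg h M P n q)
    (hh : h ≤ 0) (g : GI h P M) {m : ℕ} {y : ℤ} (hs : SelF (_root_.cor P M) m y)
    (hR : M = rowm m (P m - y) + R) (hP' : ∀ i, P' i = P i - if m < i then 2 * h else 0) :
    GI h P' (R + {(m + 1, P (m + 1) - y - h)}) := by
  have hy := g.sel' hh hs
  subst hy
  have hRM : ∀ p ∈ R, p ∈ M := fun p hp => by rw [hR]; exact Multiset.mem_add.2 (Or.inr hp)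
  have hn := imag_nonneg c hh (m + 1)
  have hge : ∀ i, P i ≤ P' i := fun i => by rw [hP']; split_ifs <;> omega
  -- the degenerate case
  have hdeg : ∀ p ∈ R, P (m + 1) ≠ 0 := by
    intro p hp h0
    rcases imag_degenerate c hh g h0 with hM | ⟨hh0, j, hj, hM⟩
    · have := hRM p hp
      rw [hM] at this; simp at this
    · have h1 := hs.max (j, 0) (by
        rw [mem_cor, (imag_zero c hh h0).1, hM]; simp) rfl
      simp only at h1
      rw [hM, rowm_pos (by omega)] at hR
      have h2 := congrArg Multiset.card hR
      simp only [Multiset.card_singleton, Multiset.card_add] at h2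
      have h3 : R.card = 0 := by omega
      rw [Multiset.card_eq_zero.1 h3] at hp
      simp at hp
  refine ⟨?_, ?_, ?_⟩
  · intro p hp
    rcases Multiset.mem_add.1 hp with h1 | h1
    · exact g.rig p (hRM p h1)
    · rw [Multiset.mem_singleton.1 h1]; simp only; omega
  · intro p hp
    rcases Multiset.mem_add.1 hp with h1 | h1
    · have := g.cor p (hRM p h1)
      have := hge p.1
      omega
    · rw [Multiset.mem_singleton.1 h1]; simp only
      rw [hP', if_pos (by omega)]; omega
  · intro r S hS hr p hp
    by_cases hrn : r = (m + 1, P (m + 1) - 0 - h)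
    · subst hrn
      have hSR : R = S := by
        rw [add_comm] at hS
        exact add_left_cancel hS
      subst hSR
      exfalso
      apply hdeg p hp
      simp only at hr; omega
    · have hrR : r ∈ R := by
        have : r ∈ R + {(m + 1, P (m + 1) - 0 - h)} := by
          rw [hS]; exact Multiset.mem_add.2 (Or.inl (Multiset.mem_singleton_self _))
        rcases Multiset.mem_add.1 this with h1 | h1
        · exact h1
        · exact absurd (Multiset.mem_singleton.1 h1) hrn
      obtain ⟨R1, hR1⟩ := mem_split hrR
      rw [hR1, add_assoc] at hS
      have hS1 := add_left_cancel hS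
      rw [← hS1] at hp
      rcases Multiset.mem_add.1 hp with h1 | h1
      · exact g.uniq r (rowm m (P m - 0) + R1) (by rw [hR, hR1, add_left_comm]) hr p
          (Multiset.mem_add.2 (Or.inr h1))
      · rw [Multiset.mem_singleton.1 h1]; simp only
        have h2 := imag_P1 c hh (hRM r hrR)
        have h3 := imag_monotone c hh (show 1 ≤ m + 1 by omega)
        have h4 := hdeg r hrR
        constructor <;> omega

/-- The invariant. -/
structure G (A : I → I → ℤ) (ν : RCraw I) : Prop where
  wf : Wf ν
  re : ∀ a, A a a = 2 → ∀ p ∈ ν a, -(p.1 : ℤ) ≤ p.2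
  im : ∀ a h, A a a = 2 * h → h ≤ 0 → GI h (vac A ν a) (ν a)

theorem diag_cases {A : I → I → ℤ} (hA : IsBorcherdsCartan A) (a : I) :
    A a a = 2 ∨ ∃ h, A a a = 2 * h ∧ h ≤ 0 := by
  rcases hA.diag a with h | ⟨h1, h⟩
  · exact Or.inl h
  · obtain ⟨k, hk⟩ := h; exact Or.inr ⟨k, by omega, by omega⟩

theorem diag_half {A : I → I → ℤ} (hA : IsBorcherdsCartan A) (a : I) : ∃ h, A a a = 2 * h := by
  rcases diag_cases hA a with h | ⟨h, h1, _⟩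
  · exact ⟨1, by omega⟩
  · exact ⟨h, h1⟩

theorem G.empty (A : I → I → ℤ) : G A (emptyRC : RCraw I) := by
  refine ⟨⟨?_, ?_⟩, ?_, ?_⟩
  · unfold FinS emptyRC; simp
  · intro a p hp; simp [emptyRC] at hp
  · intro a _ p hp; simp [emptyRC] at hp
  · intro a h _ _
    refine ⟨?_, ?_, ?_⟩
    · intro p hp; simp [emptyRC] at hp
    · intro p hp; simp [emptyRC] at hp
    · intro r R hR
      have := congrArg Multiset.card hR
      simp [emptyRC] at this

theorem G.step {A : I → I → ℤ} (hA : IsBorcherdsCartan A) {ν : RCraw I} (g : G A ν) (b : I) :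
    G A (fStar A b ν) := by
  obtain ⟨k, hk⟩ := diag_half hA b
  obtain ⟨m, y, ht⟩ := selF_ex (cor (vac A ν b) (ν b))
  obtain ⟨T, hT⟩ := exists_rest_cor (vac_zero A ν b) ht
  obtain ⟨sw, s1, s2, s3, s5, s4⟩ := s_desc A b hk g.wf ht hT
  obtain ⟨n, c, -⟩ := exists_cfg hA g.wf.fin b (g.wf.pos b) hk
  refine ⟨sw, ?_, ?_⟩
  · intro a ha
    by_cases hab : a = b
    · subst hab
      have hk1 : k = 1 := by omega
      subst hk1
      rw [s1]
      intro p hp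
      have hre := g.re a ha
      rcases Multiset.mem_add.1 hp with h1 | h1
      · exact hre p (by rw [hT]; exact Multiset.mem_add.2 (Or.inr h1))
      · rw [Multiset.mem_singleton.1 h1]; simp only
        by_contra hc
        push_cast at hc
        have hQm : y ≤ vac A ν a m + m := by
          rcases ht.mem with ⟨rfl, rfl⟩ | h
          · rw [c.P0]; simp
          · have := hre _ (mem_cor.1 h)
            simp only at this; omega
        obtain ⟨L, hL⟩ := c.ev
        have key := right_aux (fun i => vac A ν a i + i) m y (by push_cast; omega)
          (by push_cast; omega) (fun j hj => by
            have h3 := c.no_row (i := m + j) (fun p hp he => by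
              have h4 := hre p hp
              have hp' : (p.1, vac A ν a p.1 - p.2) ∈ cor (vac A ν a) (ν a) := by
                rw [mem_cor]; simpa using hp
              have h5 := ht.le _ hp'
              have h6 := ht.max _ hp'
              simp only at h5 h6
              have h7 : vac A ν a p.1 - p.2 ≠ y := fun h => by have := h6 h; omega
              rw [he] at h4 h5 h7
              push_cast at hj h4
              omega)
            have h4 := c.n0 (m + j + 1)
            push_cast
            omega)
        have h8 := (key (L + (y - pInf A ν a).natAbs + 1)).2
        rw [hL _ (by omega)] at h8
        push_cast at h8
        have := Int.le_natAbs (a := y - pInf A ν a)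
        push_cast at this
        omega
    · rw [s2 a hab]; exact g.re a ha
  · intro a h hh h0
    by_cases hab : a = b
    · subst hab
      have hk1 : k = h := by omega
      subst hk1
      rw [s1]
      exact GI.step c h0 (g.im a k hh h0) ht hT (fun i => by rw [s3, hk])
    · rw [s2 a hab]
      apply (g.im a h hh h0).mono
      intro i
      rw [s3]
      have := hA.offdiag a b hab
      split_ifs <;> omega

theorem imag_K0 {A : I → I → ℤ} (hA : IsBorcherdsCartan A) (a : I) {h : ℤ} (hh : A a a = 2 * h)
    (h0 : h ≤ 0) {ν : RCraw I} (g : G A ν) {m : ℕ} (hm : vac A ν a (m + 1) = 0) :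
    fOp A a ν = fStar A a ν := by
  have gi := g.im a h hh h0
  obtain ⟨n, c, hn⟩ := exists_cfg hA g.wf.fin a (g.wf.pos a) hh
  obtain ⟨hP, hn0⟩ := imag_zero c h0 hm
  obtain ⟨l, x, hs⟩ := selF_ex (ν a)
  obtain ⟨m, y, ht⟩ := selF_ex (cor (vac A ν a) (ν a))
  have hx := gi.sel h0 hs
  have hy := gi.sel' h0 ht
  subst hx hy
  have hfin : m = l ∧ ∀ p ∈ ν a, A a a = 0 ∨ p.1 ≤ l := by
    rcases imag_degenerate c h0 gi hm with hM | ⟨hh0, j, hj, hM⟩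
    · rw [hM] at hs ht ⊢
      refine ⟨?_, by simp⟩
      rcases hs.mem with h1 | h1
      · rcases ht.mem with h2 | h2
        · omega
        · simp [cor] at h2
      · simp at h1
    · refine ⟨?_, fun _ _ => Or.inl (by omega)⟩
      have h1 := hs.max (j, 0) (by rw [hM]; simp) rfl
      have h2 := ht.max (j, 0) (by rw [mem_cor, hP, hM]; simp) rfl
      have h3 := hs.mem
      have h4 := ht.mem
      rw [mem_cor, hP] at h4
      rw [hM] at h3 h4
      simp only [Multiset.mem_singleton, Prod.mk.injEq] at h1 h2 h3 h4
      omega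
  obtain ⟨rfl, h5⟩ := hfin
  refine K0core A a g.wf hs ht hh (by rw [hP]; rfl) (by rw [hP]; rfl) ?_ h5
  intro b hb p hp hlt
  exact hn p.1 (hn0 _ (by omega)) b hb p hp rfl

theorem imag_D {A : I → I → ℤ} (hA : IsBorcherdsCartan A) (a : I) {h : ℤ} (hh : A a a = 2 * h)
    (h0 : h ≤ 0) {ν : RCraw I} (g : G A ν) : fOp A a (fStar A a ν) = fStar A a (fOp A a ν) ∨
      (fOp A a (fStar A a ν) = fStar A a (fStar A a ν) ∧
        fStar A a (fOp A a ν) = fOp A a (fOp A a ν)) := by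
  have gi := g.im a h hh h0
  obtain ⟨n, c, hn⟩ := exists_cfg hA g.wf.fin a (g.wf.pos a) hh
  obtain ⟨l, x, hs⟩ := selF_ex (ν a)
  obtain ⟨m, y, ht⟩ := selF_ex (cor (vac A ν a) (ν a))
  obtain ⟨T, hT⟩ := exists_rest_cor (vac_zero A ν a) ht
  have hx := gi.sel h0 hs
  have hy := gi.sel' h0 ht
  subst hx hy
  by_cases hpos : ∀ i, 1 ≤ vac A ν a (i + 1) - h
  · left
    obtain ⟨key, -, -⟩ := sel_facts c.P0 hs ht
    obtain ⟨R, hR⟩ : ∃ R, ν a = rowm l 0 + rowm m (vac A ν a m - 0) + R := by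
      by_cases hl : l = 0
      · exact ⟨T, by rw [hl, rowm_zero, zero_add]; exact hT⟩
      · have hmem : (l, (0 : ℤ)) ∈ ν a := by
          rcases hs.mem with h1 | h1
          · exact absurd h1.1 hl
          · exact h1
        have h1 := gi.rig _ hmem
        rw [hT, Multiset.mem_add, mem_rowm] at hmem
        rcases hmem with ⟨h2, h3⟩ | h2
        · obtain ⟨j, rfl⟩ : ∃ j, m = j + 1 := ⟨m - 1, by omega⟩
          have := hpos j
          simp only [Prod.mk.injEq] at h3 h1
          omega
        · obtain ⟨R, hR⟩ := mem_split h2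
          refine ⟨R, ?_⟩
          rw [hR, ← add_assoc, add_comm (rowm m _)] at hT
          rw [rowm_pos hl]; exact hT
    have hRM : ∀ p ∈ rowm m (vac A ν a m - 0) + R, p ∈ ν a := fun p hp => by
      rw [hR, add_assoc]; exact Multiset.mem_add.2 (Or.inr hp)
    have hRM' : ∀ p ∈ rowm l 0 + R, p ∈ ν a := fun p hp => by
      rw [hR, add_right_comm]; exact Multiset.mem_add.2 (Or.inl hp)
    refine comm_core A a g.wf hs ht hh hR ⟨le_rfl, ?_, ?_, ?_⟩ ⟨le_rfl, ?_, ?_, ?_⟩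
    · rintro ⟨i, z⟩ hp
      rcases Multiset.mem_add.1 hp with h | h
      · have := (key _ (hRM _ (mem_cor.1 h))).2.1
        simp only at this ⊢; linarith
      · simp only [Multiset.mem_singleton, Prod.mk.injEq] at h
        have := hpos l
        simp only; omega
    · by_cases hm0 : m = 0
      · exact Or.inl ⟨hm0, rfl⟩
      · right
        rw [Multiset.mem_add, mem_cor, Multiset.mem_add, mem_rowm]
        exact Or.inl (Or.inl ⟨hm0, rfl⟩)
    · rintro ⟨i, z⟩ hp hz
      rcases Multiset.mem_add.1 hp with h | h
      · have := (key _ (hRM _ (mem_cor.1 h))).2.2.2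
        simp only at this hz ⊢
        exact this (by linarith)
      · simp only [Multiset.mem_singleton, Prod.mk.injEq] at h
        have := hpos l
        simp only at hz ⊢
        omega
    · rintro ⟨i, z⟩ hp
      rcases Multiset.mem_add.1 hp with h | h
      · exact (key _ (hRM' _ h)).1
      · simp only [Multiset.mem_singleton, Prod.mk.injEq] at h
        have := hpos m
        simp only; omega
    · by_cases hl0 : l = 0
      · exact Or.inl ⟨hl0, rfl⟩
      · right
        rw [Multiset.mem_add, Multiset.mem_add, mem_rowm]
        exact Or.inl (Or.inl ⟨hl0, rfl⟩)
    · rintro ⟨i, z⟩ hp hz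
      rcases Multiset.mem_add.1 hp with h | h
      · exact (key _ (hRM' _ h)).2.2.1 hz
      · simp only [Multiset.mem_singleton, Prod.mk.injEq] at h
        have := hpos m
        simp only at hz ⊢
        omega
  · right
    push Not at hpos
    obtain ⟨i, hi⟩ := hpos
    have h1 := imag_nonneg c h0 (i + 1)
    have hP1 : vac A ν a (i + 1) = 0 := by omega
    have hh0 : h = 0 := by omega
    have e := imag_K0 hA a hh h0 g hP1
    obtain ⟨-, -, -, s3, -⟩ := s_desc A a hh g.wf ht hT
    have e2 := imag_K0 hA a hh h0 (g.step hA a) (m := i) (by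
      rw [s3, hP1, hh, hh0]; simp)
    rw [e]
    exact ⟨e2, e2.symm⟩

theorem imag_eOp_none {A : I → I → ℤ} {a : I} {h : ℤ} (hh : A a a = 2 * h) (h0 : h ≤ 0)
    {ν : RCraw I} (g : G A ν) (he : eOp A a ν = none) : ∀ p ∈ ν a, p.2 ≠ -h := by
  intro p hp1 hp2
  have gi := g.im a h hh h0
  obtain ⟨l', hE⟩ := exists_selE_of_min A a (ν a) (-h) gi.rig ⟨p, hp1, hp2⟩
    (by rw [if_neg (by omega), hh]; omega)
  obtain ⟨R, hR⟩ := mem_split hE.mem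
  rw [eOp_eq A a ν (g.wf.pos a) hE hR] at he
  exact absurd he (by simp)

theorem imag_L2 {A : I → I → ℤ} (hA : IsBorcherdsCartan A) (a : I) {h : ℤ} (hh : A a a = 2 * h)
    (h0 : h ≤ 0) {ν ν' : RCraw I} (g : G A ν) (hn : eOp A a ν = none)
    (he : eOp A a (fStar A a ν) = some ν') : fOp A a ν = fStar A a ν := by
  have gi := g.im a h hh h0
  obtain ⟨m, y, ht⟩ := selF_ex (cor (vac A ν a) (ν a))
  obtain ⟨T, hT⟩ := exists_rest_cor (vac_zero A ν a) ht
  have hy := gi.sel' h0 ht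
  subst hy
  obtain ⟨sw, s1, -⟩ := s_desc A a hh g.wf ht hT
  obtain ⟨l', x', hE⟩ := exists_selE A a _ he
  have hc := hE.cond
  rw [if_neg (by omega), hh] at hc
  have hmem := hE.mem
  rw [s1, Multiset.mem_add, Multiset.mem_singleton, Prod.mk.injEq] at hmem
  rcases hmem with h1 | h1
  · exfalso
    refine imag_eOp_none hh h0 g hn (l', x') (by rw [hT]; exact Multiset.mem_add.2 (Or.inr h1)) ?_
    simp only; omega
  · exact imag_K0 hA a hh h0 g (m := m) (by omega)

theorem D_all {A : I → I → ℤ} (hA : IsBorcherdsCartan A) (a : I) {ν : RCraw I} (g : G A ν) :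
    fOp A a (fStar A a ν) = fStar A a (fOp A a ν) ∨
      (fOp A a (fStar A a ν) = fStar A a (fStar A a ν) ∧
        fStar A a (fOp A a ν) = fOp A a (fOp A a ν)) := by
  rcases diag_cases hA a with h | ⟨h, h1, h2⟩
  · exact real_D hA a h g.wf
  · exact imag_D hA a h1 h2 g

theorem L2_all {A : I → I → ℤ} (hA : IsBorcherdsCartan A) (a : I)
    {ν ν' : RCraw I} (g : G A ν) (hn : eOp A a ν = none)
    (he : eOp A a (fStar A a ν) = some ν') : fOp A a ν = fStar A a ν := by
  rcases diag_cases hA a with h | ⟨h, h1, h2⟩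
  · exact real_L2 hA a h g.wf hn he
  · exact imag_L2 hA a h1 h2 g hn he


theorem E1 {A : I → I → ℤ} (hA : IsBorcherdsCartan A) (a : I) {ν : RCraw I} (g : G A ν) :
    eOp A a (fOp A a ν) = some ν := by
  obtain ⟨h, hh⟩ := diag_half hA a
  obtain ⟨l, x, hs⟩ := selF_ex (ν a)
  obtain ⟨R, hR⟩ := exists_rest hs.mem
  obtain ⟨fw, f1, f2, -⟩ := f_desc A a hh g.wf hs hR
  have hRM : ∀ p ∈ R, p ∈ ν a := fun p hp => by rw [hR]; exact Multiset.mem_add.2 (Or.inr hp)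
  have hE : SelE A a (fOp A a ν a) (l + 1) (x - h) := by
    rw [f1]
    rcases diag_cases hA a with h2 | ⟨h', h1, h0⟩
    · have h1 : h = 1 := by omega
      subst h1
      have hR1 : ∀ q ∈ R, l < q.1 → x + 1 ≤ q.2 := fun q hq hl => by
        have h1 := hs.le q (hRM q hq)
        have h2 := hs.max q (hRM q hq)
        have : q.2 ≠ x := fun h => by have := h2 h; omega
        omega
      refine ⟨?_, ?_, ?_, ?_⟩
      · intro p hp
        rcases Multiset.mem_add.1 hp with h | h
        · obtain ⟨q, hq, rfl⟩ := Multiset.mem_map.1 h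
          have h1 := hs.le q (hRM q hq)
          have h2 := hR1 q hq
          simp only
          split_ifs with h3
          · have := h2 h3
            omega
          · omega
        · rw [Multiset.mem_singleton.1 h]
      · exact Multiset.mem_add.2 (Or.inr (Multiset.mem_singleton_self _))
      · intro p hp hx
        rcases Multiset.mem_add.1 hp with h | h
        · obtain ⟨q, hq, rfl⟩ := Multiset.mem_map.1 h
          have h1 := hs.le q (hRM q hq)
          simp only at hx ⊢
          split_ifs at hx with h3
          · omega
          · omega
        · rw [Multiset.mem_singleton.1 h]
      · rw [if_pos h2]; have := hs.le0; omega
    · have h1 : h' = h := by omega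
      subst h1
      have gi := g.im a h' hh h0
      have hx := gi.sel h0 hs
      subst hx
      refine ⟨?_, ?_, ?_, ?_⟩
      · intro p hp
        rcases Multiset.mem_add.1 hp with h | h
        · obtain ⟨q, hq, rfl⟩ := Multiset.mem_map.1 h
          have h1 := gi.rig q (hRM q hq)
          simp only
          split_ifs with h3 <;> omega
        · rw [Multiset.mem_singleton.1 h]
      · exact Multiset.mem_add.2 (Or.inr (Multiset.mem_singleton_self _))
      · intro p hp hx
        rcases Multiset.mem_add.1 hp with h | h
        · obtain ⟨q, hq, rfl⟩ := Multiset.mem_map.1 h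
          simp only at hx ⊢
          split_ifs at hx with h3
          · omega
          · exfalso
            have hq1 := g.wf.pos a q (hRM q hq)
            have hm : (l, (0 : ℤ)) ∈ ν a := by
              rcases hs.mem with h | h
              · omega
              · exact h
            have hz := gi.rig _ hm
            simp only at hz
            rw [rowm_pos (by omega)] at hR
            have := (gi.uniq _ _ hR (by simp only; omega) q hq).2
            omega
        · rw [Multiset.mem_singleton.1 h]
      · rw [if_neg (by omega), hh]; omega
  rw [eOp_eq A a _ (fw.pos a) hE (R := shf l (2 * h) R) (by rw [f1, add_comm])]
  congr 1
  funext b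
  by_cases hb : b = a
  · subst hb
    rw [if_pos rfl, hh, ushf_shf, hdiv rfl, hR, add_comm, Nat.add_sub_cancel, sub_add_cancel]
  · rw [if_neg hb, f2 b hb, ushf_shf]

theorem E2 {A : I → I → ℤ} (hA : IsBorcherdsCartan A) (a : I) {ν ν' : RCraw I} (g : G A ν)
    (he : eOp A a ν = some ν') : fOp A a ν' = ν := by
  obtain ⟨h, hh⟩ := diag_half hA a
  obtain ⟨l, x, hE⟩ := exists_selE A a ν he
  obtain ⟨k, rfl⟩ : ∃ k, l = k + 1 := ⟨l - 1, by
    have := g.wf.pos a _ hE.mem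
    simp only at this; omega⟩
  obtain ⟨R, hR⟩ := mem_split hE.mem
  have hRM : ∀ p ∈ R, p ∈ ν a := fun p hp => by rw [hR]; exact Multiset.mem_add.2 (Or.inr hp)
  rw [eOp_eq A a ν (g.wf.pos a) hE hR, Option.some.injEq] at he
  have e1 : ν' a = rowm k (x + h) + ushf (k + 1) (2 * h) R := by
    rw [← he]; simp only [if_true]; rw [hh, hdiv rfl, Nat.add_sub_cancel, add_comm]
  have e2 : ∀ b, b ≠ a → ν' b = ushf (k + 1) (A b a) (ν b) := by
    intro b hb; rw [← he]; simp [hb]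
  have hpos : Pos (ν' a) := by
    rw [e1]
    apply pos_add
    · intro p hp
      obtain ⟨h1, h2⟩ := mem_rowm.1 hp
      rw [h2]; simp only; omega
    · intro p hp
      obtain ⟨q, hq, rfl⟩ := Multiset.mem_map.1 hp
      exact g.wf.pos a q (hRM q hq)
  have hc := hE.cond
  have hS : SelF (ν' a) k (x + h) := by
    rw [e1]
    rcases diag_cases hA a with h2 | ⟨h', h1, h0⟩
    · have h1 : h = 1 := by omega
      subst h1
      rw [if_pos h2] at hc
      have hR1 : ∀ q ∈ R, q.1 < k + 1 → x + 1 ≤ q.2 := fun q hq hl => by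
        have h1 := hE.le q (hRM q hq)
        have h2 := hE.min q (hRM q hq)
        have : q.2 ≠ x := fun h => by have := h2 h; omega
        omega
      refine ⟨by omega, ?_, ?_, ?_⟩
      · intro p hp
        rcases Multiset.mem_add.1 hp with h | h
        · rw [(mem_rowm.1 h).2]
        · obtain ⟨q, hq, rfl⟩ := Multiset.mem_map.1 h
          have h1 := hE.le q (hRM q hq)
          have h2 := hR1 q hq
          simp only
          split_ifs with h3
          · omega
          · have := h2 (by omega)
            omega
      · by_cases hk : k = 0
        · left
          have := g.re a h2 _ hE.mem
          simp only at this
          push_cast at this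
          exact ⟨hk, by omega⟩
        · right
          exact Multiset.mem_add.2 (Or.inl (mem_rowm.2 ⟨hk, rfl⟩))
      · intro p hp hx
        rcases Multiset.mem_add.1 hp with h | h
        · rw [(mem_rowm.1 h).2]
        · obtain ⟨q, hq, rfl⟩ := Multiset.mem_map.1 h
          have h1 := hE.le q (hRM q hq)
          simp only at hx ⊢
          split_ifs at hx with h3
          · omega
          · omega
    · have h1 : h' = h := by omega
      subst h1
      rw [if_neg (by omega), hh] at hc
      have hx : x = -h' := by omega
      subst hx
      have gi := g.im a h' hh h0
      have hu := gi.uniq _ _ hR rfl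
      refine ⟨by omega, ?_, ?_, ?_⟩
      · intro p hp
        rcases Multiset.mem_add.1 hp with h | h
        · rw [(mem_rowm.1 h).2]
        · obtain ⟨q, hq, rfl⟩ := Multiset.mem_map.1 h
          have h1 := hu q hq
          simp only
          split_ifs with h3 <;> omega
      · by_cases hk : k = 0
        · exact Or.inl ⟨hk, by omega⟩
        · right
          exact Multiset.mem_add.2 (Or.inl (mem_rowm.2 ⟨hk, rfl⟩))
      · intro p hp hx
        rcases Multiset.mem_add.1 hp with h | h
        · rw [(mem_rowm.1 h).2]
        · obtain ⟨q, hq, rfl⟩ := Multiset.mem_map.1 h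
          have h1 := hu q hq
          simp only at hx ⊢
          split_ifs at hx with h3
          · omega
          · omega
  rw [fOp_eq A a ν' hpos hS e1]
  funext b
  by_cases hb : b = a
  · subst hb
    rw [if_pos rfl, hh, shf_ushf, hdiv rfl, hR, add_sub_cancel_right, add_comm]
  · rw [if_neg hb, e2 b hb, shf_ushf]

/-- Configurations generated by the star operators. -/
inductive FS (A : I → I → ℤ) : RCraw I → Prop
  | empty : FS A emptyRC
  | step (a : I) (ν : RCraw I) : FS A ν → FS A (fStar A a ν)

theorem FS.g {A : I → I → ℤ} (hA : IsBorcherdsCartan A) {ν : RCraw I} (h : FS A ν) : G A ν := by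
  induction h with
  | empty => exact G.empty A
  | step a ν _ ih => exact ih.step hA a

theorem f_empty {A : I → I → ℤ} (hA : IsBorcherdsCartan A) (a : I) :
    fOp A a emptyRC = fStar A a (emptyRC : RCraw I) := by
  obtain ⟨h, hh⟩ := diag_half hA a
  have hv : ∀ i, vac A emptyRC a i = 0 := fun i => by simp [vac, emptyRC]
  have h0 : SelF (0 : Multiset (ℕ × ℤ)) 0 0 := ⟨le_rfl, by simp, Or.inl ⟨rfl, rfl⟩, by simp⟩
  refine K0core A a (G.empty A).wf (l := 0) (x := 0) (y := 0) h0 h0 hh (by rw [hv]; rfl)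
    (by rw [hv]; rfl) ?_ ?_
  · intro b _ p hp; simp [emptyRC] at hp
  · intro p hp; simp [emptyRC] at hp

theorem FS.f {A : I → I → ℤ} (hA : IsBorcherdsCartan A) {ν : RCraw I} (h : FS A ν) (a : I) :
    FS A (fOp A a ν) := by
  induction h with
  | empty => rw [f_empty hA]; exact .step a _ .empty
  | step b μ hμ ih =>
    by_cases hab : a = b
    · subst hab
      rcases D_all hA a (hμ.g hA) with h | ⟨h, -⟩
      · rw [h]; exact .step a _ ih
      · rw [h]; exact .step a _ (.step a _ hμ)
    · rw [L0 A hA hab (hμ.g hA).wf]; exact .step b _ ih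

theorem fStar_other {A : I → I → ℤ} {a b : I} (hab : a ≠ b) (ν : RCraw I) :
    fStar A b ν a = ν a := by
  simp [fStar, hab]

theorem FS.e {A : I → I → ℤ} (hA : IsBorcherdsCartan A) {ν : RCraw I} (h : FS A ν) :
    ∀ (a : I) (ν' : RCraw I), eOp A a ν = some ν' → FS A ν' := by
  induction h with
  | empty =>
    intro a ν' he
    obtain ⟨l, x, hE⟩ := exists_selE A a _ he
    have := hE.mem
    simp [emptyRC] at this
  | step b μ hμ ih =>
    intro a ν' he
    have g := hμ.g hA
    by_cases hab : a = b
    · subst hab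
      cases hm : eOp A a μ with
      | none =>
        rw [← L2_all hA a g hm he, E1 hA a g] at he
        rw [← Option.some.inj he]; exact hμ
      | some μ1 =>
        have h1 := ih a μ1 hm
        have g1 := h1.g hA
        have hf := E2 hA a g hm
        rw [← hf] at he
        rcases D_all hA a g1 with h | ⟨-, h⟩
        · rw [← h, E1 hA a (g1.step hA a)] at he
          rw [← Option.some.inj he]; exact .step a _ h1
        · rw [h, E1 hA a ((h1.f hA a).g hA)] at he
          rw [← Option.some.inj he]; exact h1.f hA a
    · obtain ⟨l, x, hE⟩ := exists_selE A a _ he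
      rw [fStar_other hab] at hE
      obtain ⟨R, hR⟩ := mem_split hE.mem
      have hm := eOp_eq A a μ (g.wf.pos a) hE hR
      have h1 := ih a _ hm
      have hf := E2 hA a g hm
      rw [← hf, ← L0 A hA hab (h1.g hA).wf, E1 hA a ((h1.g hA).step hA b)] at he
      rw [← Option.some.inj he]; exact .step b _ h1

theorem RCinf.fs {A : I → I → ℤ} (hA : IsBorcherdsCartan A) {ν : RCraw I} (h : RCinf A ν) :
    FS A ν := by
  induction h with
  | empty => exact .empty
  | fstep a ν _ ih => exact ih.f hA a
  | estep a ν ν' _ he ih => exact ih.e hA a ν' he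

theorem RCinf.g {A : I → I → ℤ} (hA : IsBorcherdsCartan A) {ν : RCraw I} (h : RCinf A ν) :
    G A ν := (h.fs hA).g hA

theorem f_num {A : I → I → ℤ} (hA : IsBorcherdsCartan A) (a : I) {ν : RCraw I} (w : Wf ν) :
    (∀ b, rcSize (fOp A a ν) b = rcSize ν b + if b = a then 1 else 0) ∧
    (∀ b, pInf A (fOp A a ν) b = pInf A ν b - A b a) := by
  obtain ⟨h, hh⟩ := diag_half hA a
  obtain ⟨l, x, hs⟩ := selF_ex (ν a)
  obtain ⟨R, hR⟩ := exists_rest hs.mem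
  obtain ⟨-, -, -, -, h1, h2, -⟩ := f_desc A a hh w hs hR
  exact ⟨h1, h2⟩

theorem iterOpt_succ {α : Type*} (f : α → Option α) (k : ℕ) (v : α) :
    iterOpt f (k + 1) v = (f v).bind (iterOpt f k) := by
  induction k with
  | zero => cases h : f v <;> simp [iterOpt, h]
  | succ k ih =>
    rw [iterOpt, ih]
    cases h : f v <;> simp [iterOpt]

theorem iter_bound {A : I → I → ℤ} (hA : IsBorcherdsCartan A) (a : I) (k : ℕ) :
    ∀ ν : RCraw I, RCinf A ν → iterOpt (eOp A a) k ν ≠ none → (k : ℤ) ≤ rcSize ν a := by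
  induction k with
  | zero =>
    intro ν _ _
    unfold rcSize
    apply Multiset.sum_nonneg
    intro z hz
    obtain ⟨p, _, rfl⟩ := Multiset.mem_map.1 hz
    simp
  | succ k ih =>
    intro ν hν hk
    rw [iterOpt_succ] at hk
    cases he : eOp A a ν with
    | none => rw [he] at hk; simp at hk
    | some ν' =>
      rw [he, Option.bind_some] at hk
      have h' := RCinf.estep a ν ν' hν he
      have h1 := ih ν' h' hk
      have h2 := (f_num hA a (h'.g hA).wf).1 a
      rw [E2 hA a (hν.g hA) he, if_pos rfl] at h2
      push_cast; omega

theorem teRC_step {A : I → I → ℤ} (hA : IsBorcherdsCartan A) {a : I} {ν ν' : RCraw I}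
    (hν : RCinf A ν) (he : eOp A a ν = some ν') : teRC A a ν = teRC A a ν' + 1 := by
  have h' := RCinf.estep a ν ν' hν he
  have hbdd : BddAbove {k | iterOpt (eOp A a) k ν' ≠ none} := by
    refine ⟨(rcSize ν' a).toNat, fun k hk => ?_⟩
    have := iter_bound hA a k ν' h' hk
    omega
  have hmem : sSup {k | iterOpt (eOp A a) k ν' ≠ none} ∈ {k | iterOpt (eOp A a) k ν' ≠ none} :=
    Nat.sSup_mem ⟨0, by simp [iterOpt]⟩ hbdd
  apply IsGreatest.csSup_eq
  constructor
  · change iterOpt (eOp A a) (sSup {k | iterOpt (eOp A a) k ν' ≠ none} + 1) ν ≠ none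
    rw [iterOpt_succ, he]; exact hmem
  · intro k hk
    cases k with
    | zero => omega
    | succ k =>
      change iterOpt (eOp A a) (k + 1) ν ≠ none at hk
      rw [iterOpt_succ, he] at hk
      have : k ≤ sSup {k | iterOpt (eOp A a) k ν' ≠ none} := le_csSup hbdd hk
      unfold teRC
      omega

theorem e_num {A : I → I → ℤ} (hA : IsBorcherdsCartan A) {a : I} {ν ν' : RCraw I}
    (hν : RCinf A ν) (he : eOp A a ν = some ν') :
    (∀ b, rcSize ν b = rcSize ν' b + if b = a then 1 else 0) ∧
    (∀ b, pInf A ν b = pInf A ν' b - A b a) ∧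
    (A a a = 2 → epsRC A a ν' + 1 = epsRC A a ν ∧ phiRC A a ν' = phiRC A a ν + 1) ∧
      (A a a ≤ 0 → epsRC A a ν' = epsRC A a ν ∧ phiRC A a ν' = phiRC A a ν + A a a) := by
  have h' := RCinf.estep a ν ν' hν he
  have hf := E2 hA a (hν.g hA) he
  obtain ⟨h1, h2⟩ := f_num hA a (h'.g hA).wf
  rw [hf] at h1 h2
  have h3 := h2 a
  refine ⟨h1, h2, ?_, ?_⟩
  · intro h
    have h4 := teRC_step hA hν he
    unfold phiRC epsRC
    rw [if_pos h, if_pos h, h4]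
    push_cast
    constructor <;> omega
  · intro h
    unfold phiRC epsRC
    rw [if_neg (by omega), if_neg (by omega)]
    constructor <;> omega

/-- `RC(∞)` is closed under the operators `e_a`, and
`(RC(∞), e_a, f_a, ε_a, φ_a, wt)` satisfies the axioms of an abstract
`U_q(g)`-crystal. -/
theorem rc_is_abstract_crystal {I : Type*} [DecidableEq I] (A : I → I → ℤ)
    (hA : IsBorcherdsCartan A) :
    -- closure under e_a (f_a is total, so closure under f_a holds by construction)
    (∀ (a : I) (ν ν' : RCraw I), RCinf A ν → eOp A a ν = some ν' → RCinf A ν') ∧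
    -- wt(e_a v) = wt(v) + α_a
    (∀ (a : I) (ν ν' : RCraw I), RCinf A ν → eOp A a ν = some ν' →
      wtRC ν' = fun b => wtRC ν b + (if b = a then 1 else 0)) ∧
    -- wt(f_a v) = wt(v) - α_a
    (∀ (a : I) (ν : RCraw I), RCinf A ν →
      wtRC (fOp A a ν) = fun b => wtRC ν b - (if b = a then 1 else 0)) ∧
    -- φ_a(v) = ε_a(v) + ⟨h_a, wt(v)⟩
    (∀ (a : I) (ν : RCraw I), RCinf A ν →
      phiRC A a ν = epsRC A a ν + ∑ᶠ b, A a b * wtRC ν b) ∧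
    -- f_a v = v' iff v = e_a v'
    (∀ (a : I) (ν ν' : RCraw I), RCinf A ν → RCinf A ν' →
      (fOp A a ν = ν' ↔ eOp A a ν' = some ν)) ∧
    -- behaviour of ε_a, φ_a under e_a
    (∀ (a : I) (ν ν' : RCraw I), RCinf A ν → eOp A a ν = some ν' →
      (A a a = 2 → epsRC A a ν' + 1 = epsRC A a ν ∧ phiRC A a ν' = phiRC A a ν + 1) ∧
      (A a a ≤ 0 → epsRC A a ν' = epsRC A a ν ∧ phiRC A a ν' = phiRC A a ν + A a a)) ∧
    -- behaviour of ε_a, φ_a under f_a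
    (∀ (a : I) (ν : RCraw I), RCinf A ν →
      (A a a = 2 → epsRC A a (fOp A a ν) = epsRC A a ν + 1 ∧
        phiRC A a (fOp A a ν) + 1 = phiRC A a ν) ∧
      (A a a ≤ 0 → epsRC A a (fOp A a ν) = epsRC A a ν ∧
        phiRC A a (fOp A a ν) + A a a = phiRC A a ν)) := by
  have ff : ∀ (a : I) (ν : RCraw I), RCinf A ν → eOp A a (fOp A a ν) = some ν :=
    fun a ν hν => E1 hA a (hν.g hA)
  refine ⟨fun a ν ν' hν he => .estep a ν ν' hν he, ?_, ?_, ?_, ?_, ?_, ?_⟩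
  · intro a ν ν' hν he
    funext b
    have := (e_num hA hν he).1 b
    unfold wtRC
    rw [this]; ring
  · intro a ν hν
    funext b
    have := (f_num hA a (hν.g hA).wf).1 b
    unfold wtRC
    rw [this]; ring
  · intro a ν _
    unfold phiRC pInf wtRC
    rw [← finsum_neg_distrib, add_comm]
    congr 1
    exact finsum_congr fun b => by ring
  · intro a ν ν' hν hν'
    constructor
    · rintro rfl
      exact ff a ν hν
    · intro he
      exact E2 hA a (hν'.g hA) he
  · intro a ν ν' hν he
    exact (e_num hA hν he).2.2
  · intro a ν hν
    obtain ⟨-, -, h1, h2⟩ := e_num hA (.fstep a ν hν) (ff a ν hν)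
    refine ⟨fun h => ?_, fun h => ?_⟩
    · obtain ⟨h3, h4⟩ := h1 h
      exact ⟨h3.symm, h4.symm⟩
    · obtain ⟨h3, h4⟩ := h2 h
      exact ⟨h3.symm, h4.symm⟩
end
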